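/- arXiv:2212.07991 — 2 statements merged into one kernel-verified Lean document; each statement's English description precedes it below -/
import Mathlib

section
/- Let ℓ ≥ 1 and n_1, …, n_ℓ ≥ 1 be integers, n := n_1 + ⋯ + n_ℓ, and 1 ≤ k ≤ n. Let Z_1, …, Z_k ⊆ {1, …, n} satisfy |∩_{i∈Ω} Z_i| + |Ω| ≤ k for every nonempty Ω ⊆ {1, …, k}. Then for every prime power q ≥ ℓ + 1 and every integer m with m ≥ n_l for all l ∈ {1, …, ℓ} and q^m ≥ k·q^{k−1} (equivalently m ≥ k − 1 + log_q k), there exist: nonzero elements a_1, …, a_ℓ ∈ F_{q^m} that are pairwise non-σ-conjugate; elements β_{l,1}, …, β_{l,n_l} ∈ F_{q^m} that are F_q-linearly independent for each l ∈ {1, …, ℓ}; and an invertible matrix T ∈ F_{q^m}^{k×k}, such that the matrix G := T · G^LRS ∈ F_{q^m}^{k×n} satisfies G_{ij} = 0 for all i ∈ {1, …, k} and all j ∈ Z_i. In particular, G has rank k and its row space is an [n,k]_{q^m} linearized Reed–Solomon code with ℓ blocks of lengths n_1, …, n_ℓ whose minimum sum-rank distance with respect to (n_1, …, n_ℓ)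 equals n − k + 1. -/
/-- The `F_q`-rank of a vector over `F_{q^m}`. -/
noncomputable def rankFq (Fq : Type*) {K : Type*} [Field Fq] [Field K] [Algebra Fq K]
    {ι : Type*} (y : ι → K) : ℕ :=
  Module.finrank Fq (Submodule.span Fq (Set.range y))

/-- The sum-rank weight with respect to the ordered partition `(n_1, …, n_ℓ)`. -/
noncomputable def sumRankWt (Fq : Type*) {K : Type*} [Field Fq] [Field K] [Algebra Fq K]
    {ℓ : ℕ} {nn : Fin ℓ → ℕ} (x : ((l : Fin ℓ) × Fin (nn l)) → K) : ℕ :=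
  ∑ l : Fin ℓ, rankFq Fq (fun t : Fin (nn l) => x ⟨l, t⟩)

/-- The part of a polynomial that is homogeneous of degree `D` in the variable `X j`. -/
noncomputable def degComp {J F : Type*} [DecidableEq J] [CommRing F] (j : J) (D : ℕ) :
    MvPolynomial J F →ₗ[F] MvPolynomial J F :=
  MvPolynomial.weightedHomogeneousComponent (Pi.single j 1) D

theorem coeff_degComp {J F : Type*} [DecidableEq J] [CommRing F] (j : J) (D : ℕ)
    (p : MvPolynomial J F) (d : J →₀ ℕ) :
    (degComp j D p).coeff d = if d j = D then p.coeff d else 0 := by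
  have h : Finsupp.weight (Pi.single j 1 : J → ℕ) d = d j := by
    rw [Finsupp.weight_apply, Finsupp.sum]
    simp only [Pi.single_apply, smul_eq_mul, mul_ite, mul_one, mul_zero]
    rw [Finset.sum_ite_eq']
    simp only [Finsupp.mem_support_iff, ite_not]
    split_ifs with h <;> simp [h]
  rw [degComp, MvPolynomial.coeff_weightedHomogeneousComponent, h]

theorem coeff_mul_X_pow' {J F : Type*} [DecidableEq J] [CommRing F] (j : J) (e : ℕ)
    (p : MvPolynomial J F) (d : J →₀ ℕ) :
    (p * MvPolynomial.X j ^ e).coeff d =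
      if e ≤ d j then p.coeff (d - Finsupp.single j e) else 0 := by
  rw [MvPolynomial.X_pow_eq_monomial, MvPolynomial.coeff_mul_monomial']
  simp [Finsupp.single_le_iff]

theorem degComp_mul_X_pow_of_ne {J F : Type*} [DecidableEq J] [CommRing F] {i j : J}
    (hij : i ≠ j) (D e : ℕ) (p : MvPolynomial J F) :
    degComp j D (p * MvPolynomial.X i ^ e) = degComp j D p * MvPolynomial.X i ^ e := by
  ext d
  simp only [coeff_degComp, coeff_mul_X_pow', Finsupp.tsub_apply, Finsupp.single_apply,
    if_neg hij, tsub_zero]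
  split_ifs <;> rfl

/-- `f` is the coefficient vector of a polynomial with exponents `e 0, …, e (k - τ - 1)` that
vanishes at the variables indexed by `Z`. -/
def IsVanishingRow {J F : Type*} [CommRing F] (e : ℕ → ℕ) (k : ℕ) (Z : Finset J) (τ : ℕ)
    (f : ℕ → MvPolynomial J F) : Prop :=
  (∀ s, k ≤ s + τ → f s = 0) ∧
    ∀ j ∈ Z, ∑ s ∈ Finset.range k, f s * MvPolynomial.X j ^ e s = 0

namespace IsVanishingRow

variable {J F : Type*} [CommRing F] {e : ℕ → ℕ} {k τ τ' : ℕ} {Z Z' : Finset J}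
  {f g : ℕ → MvPolynomial J F}

theorem mono (hZ : Z' ⊆ Z) (hτ : τ' ≤ τ) (hf : IsVanishingRow e k Z τ f) :
    IsVanishingRow e k Z' τ' f :=
  ⟨fun s hs => hf.1 s (by omega), fun j hj => hf.2 j (hZ hj)⟩

theorem sum {ι : Type*} {I : Finset ι} {f : ι → ℕ → MvPolynomial J F}
    (hf : ∀ i ∈ I, IsVanishingRow e k Z τ (f i)) :
    IsVanishingRow e k Z τ (∑ i ∈ I, f i) := by
  refine ⟨fun s hs => ?_, fun j hj => ?_⟩
  · rw [Finset.sum_apply]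
    exact Finset.sum_eq_zero fun i hi => (hf i hi).1 s hs
  · simp only [Finset.sum_apply, Finset.sum_mul]
    rw [Finset.sum_comm]
    exact Finset.sum_eq_zero fun i hi => (hf i hi).2 j hj

theorem degComp_erase [DecidableEq J] (he : StrictMono e) {j : J} {D : ℕ}
    (hD : ∀ s d, (f s).coeff d ≠ 0 → d j ≤ D) (hf : IsVanishingRow e k Z τ f) :
    IsVanishingRow e k (Z.erase j) (τ + if j ∈ Z then 1 else 0)
      (fun s => degComp j D (f s)) := by
  have hsum : ∀ i ∈ Z.erase j,
      ∑ s ∈ Finset.range k, degComp j D (f s) * MvPolynomial.X i ^ e s = 0 := by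
    intro i hi
    rw [Finset.mem_erase] at hi
    simp_rw [← degComp_mul_X_pow_of_ne hi.1, ← map_sum, hf.2 i hi.2, map_zero]
  refine ⟨fun s hs => ?_, hsum⟩
  by_cases hs' : k ≤ s + τ
  · simp [hf.1 s hs']
  · have hj : j ∈ Z := by
      by_contra h
      simp only [h, if_false] at hs
      omega
    simp only [hj, if_true] at hs
    ext d
    rw [coeff_degComp, MvPolynomial.coeff_zero]
    split_ifs with hd
    swap; · rfl
    have h0 := congrArg (MvPolynomial.coeff (d + Finsupp.single j (e s))) (hf.2 j hj)
    rw [MvPolynomial.coeff_sum, Finset.sum_eq_single s] at h0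
    · simpa [coeff_mul_X_pow'] using h0
    · intro t _ hts
      rcases lt_or_gt_of_ne hts with h | h
      · rw [coeff_mul_X_pow']
        split_ifs
        swap; · rfl
        by_contra hne
        have := hD t _ hne
        have := he h
        simp at *
        omega
      · rw [hf.1 t (by omega)]
        simp
    · intro h
      exact absurd (Finset.mem_range.2 (by omega)) h

/-- A common bound for the degrees in `X j`, attained at a given nonzero polynomial. -/
theorem exists_degree_bound [DecidableEq J] {ι : Type*} (j : J) (S : Finset ι)
    (p : ι → MvPolynomial J F) (h : ∃ i ∈ S, p i ≠ 0) :
    ∃ D, (∀ i ∈ S, ∀ d, (p i).coeff d ≠ 0 → d j ≤ D) ∧ ∃ i ∈ S, degComp j D (p i) ≠ 0 := by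
  classical
  obtain ⟨i₀, hi₀, hp⟩ := h
  have hne : (S.filter fun i => p i ≠ 0).Nonempty := ⟨i₀, by simp [hi₀, hp]⟩
  obtain ⟨i, hi, hmax⟩ := Finset.exists_max_image _ (fun i => (p i).degreeOf j) hne
  rw [Finset.mem_filter] at hi
  refine ⟨(p i).degreeOf j, fun i' hi' d hd => ?_, i, hi.1, ?_⟩
  · refine le_trans ?_ (hmax i' (Finset.mem_filter.2 ⟨hi', fun h => hd (by simp [h])⟩))
    exact MvPolynomial.monomial_le_degreeOf j (MvPolynomial.mem_support_iff.2 hd)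
  · have hs : (p i).support.Nonempty := MvPolynomial.support_nonempty.2 hi.2
    obtain ⟨d, hd, hdm⟩ := Finset.exists_mem_eq_sup _ hs (fun d => d j)
    rw [← MvPolynomial.degreeOf_eq_sup] at hdm
    intro h0
    have := congrArg (MvPolynomial.coeff d) h0
    rw [coeff_degComp, if_pos hdm.symm] at this
    exact MvPolynomial.mem_support_iff.1 hd this

theorem eq_zero_of_le_card_add [DecidableEq J] (he : StrictMono e)
    (hk : k ≤ Z.card + τ) (hf : IsVanishingRow e k Z τ f) : f = 0 := by
  induction h : Z.card generalizing Z τ f with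
  | zero =>
    funext s
    exact hf.1 s (by omega)
  | succ n ih =>
    obtain ⟨j, hj⟩ : Z.Nonempty := Finset.card_pos.1 (by omega)
    by_contra hne
    have hex : ∃ s ∈ Finset.range k, f s ≠ 0 := by
      by_contra! hall
      refine hne (funext fun s => ?_)
      by_cases hs : s < k
      · exact hall s (Finset.mem_range.2 hs)
      · exact hf.1 s (by omega)
    obtain ⟨D, hD, s, -, hs⟩ := exists_degree_bound j _ f hex
    have hf' := hf.degComp_erase he (j := j) (D := D) (fun s d hd => by
      by_cases hs : s < k
      · exact hD s (Finset.mem_range.2 hs) d hd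
      · exact absurd (by simp [hf.1 s (by omega)]) hd)
    have hc := Finset.card_erase_of_mem hj
    rw [if_pos hj] at hf'
    exact hs (congrFun (ih (by omega) hf' (by omega)) s)

end IsVanishingRow

/-- Generic rows with prescribed zeros are linearly independent under the GM–MDS condition. -/
theorem IsVanishingRow.eq_zero_of_sum_eq_zero {J F ι : Type*} [CommRing F] {e : ℕ → ℕ}
    (he : StrictMono e) {k : ℕ} (R : Finset ι) (Z : ι → Finset J) (τ : ι → ℕ)
    (f : ι → ℕ → MvPolynomial J F)
    (hd : ∀ i ∈ R, (Z i).card + τ i < k)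
    (hc : ∀ I ⊆ R, I.Nonempty → ∀ W t, (∀ i ∈ I, W ⊆ Z i ∧ t ≤ τ i) →
      ∑ i ∈ I, (k - (Z i).card - τ i) + W.card + t ≤ k)
    (hf : ∀ i ∈ R, IsVanishingRow e k (Z i) (τ i) (f i)) (hsum : ∑ i ∈ R, f i = 0) :
    ∀ i ∈ R, f i = 0 := by
  classical
  induction hN : R.card using Nat.strong_induction_on generalizing R Z τ f with
  | _ N ihR =>
  induction hM : ∑ i ∈ R, (Z i).card using Nat.strong_induction_on generalizing Z τ f with
  | _ M ihZ =>
  by_cases hR : R.Nonempty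
  swap
  · rw [Finset.not_nonempty_iff_eq_empty] at hR
    simp [hR]
  by_cases htight : ∃ I ⊂ R, 2 ≤ I.card ∧ ∃ W t, (∀ i ∈ I, W ⊆ Z i ∧ t ≤ τ i) ∧
      ∑ i ∈ I, (k - (Z i).card - τ i) + W.card + t = k
  · obtain ⟨I, hIR, hI2, W, t, hWt, heq⟩ := htight
    have hIcard := Finset.card_lt_card hIR
    obtain ⟨i₀, hi₀⟩ : I.Nonempty := Finset.card_pos.1 (by omega)
    have hpos : 0 < ∑ i ∈ I, (k - (Z i).card - τ i) :=
      Finset.sum_pos (fun i hi => by have := hd i (hIR.1 hi); omega) ⟨i₀, hi₀⟩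
    have hmem : i₀ ∉ R \ I := by simp [hi₀]
    have hnew := ihR (insert i₀ (R \ I)).card (by
        rw [Finset.card_insert_of_notMem hmem, Finset.card_sdiff_of_subset hIR.1]
        omega) (insert i₀ (R \ I)) (Function.update Z i₀ W) (Function.update τ i₀ t)
        (Function.update f i₀ (∑ i ∈ I, f i)) ?_ ?_ ?_ ?_ rfl
    · have hout : ∀ i ∈ R \ I, f i = 0 := fun i hi => by
        have := hnew i (Finset.mem_insert_of_mem hi)
        rwa [Function.update_of_ne (ne_of_mem_of_not_mem hi hmem)] at this
      have hI0 : ∑ i ∈ I, f i = 0 := by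
        have := hnew i₀ (Finset.mem_insert_self _ _)
        rwa [Function.update_self] at this
      have hin := ihR I.card (by omega) I Z τ f (fun i hi => hd i (hIR.1 hi))
        (fun I' hI' => hc I' (hI'.trans hIR.1)) (fun i hi => hf i (hIR.1 hi)) hI0 rfl
      intro i hi
      by_cases h : i ∈ I
      · exact hin i h
      · exact hout i (Finset.mem_sdiff.2 ⟨hi, h⟩)
    · intro i hi
      rcases eq_or_ne i i₀ with rfl | hne
      · simp only [Function.update_self]
        omega
      · simp only [Function.update_of_ne hne]
        exact hd i (Finset.mem_sdiff.1 (Finset.mem_of_mem_insert_of_ne hi hne)).1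
    · intro I' hI' hI'ne W' t' hb
      by_cases hi₀' : i₀ ∈ I'
      · have hE : I'.erase i₀ ⊆ R \ I := fun i hi => by
          rw [Finset.mem_erase] at hi
          exact Finset.mem_of_mem_insert_of_ne (hI' hi.2) hi.1
        have hdisj : Disjoint (I'.erase i₀) I :=
          Finset.disjoint_of_subset_left hE Finset.sdiff_disjoint
        have hW' : W' ⊆ W ∧ t' ≤ t := by simpa using hb i₀ hi₀'
        have hb' : ∀ i ∈ I'.erase i₀ ∪ I, W' ⊆ Z i ∧ t' ≤ τ i := by
          intro i hi
          rcases Finset.mem_union.1 hi with h | h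
          · have hne := Finset.ne_of_mem_erase h
            simpa [Function.update_of_ne hne] using hb i (Finset.mem_of_mem_erase h)
          · exact ⟨hW'.1.trans (hWt i h).1, hW'.2.trans (hWt i h).2⟩
        have := hc (I'.erase i₀ ∪ I)
          (Finset.union_subset (hE.trans Finset.sdiff_subset) hIR.1)
          ⟨i₀, Finset.mem_union_right _ hi₀⟩ W' t' hb'
        rw [Finset.sum_union hdisj] at this
        rw [← Finset.add_sum_erase _ _ hi₀']
        have hcongr : ∑ i ∈ I'.erase i₀, (k - (Function.update Z i₀ W i).card -
            Function.update τ i₀ t i) = ∑ i ∈ I'.erase i₀, (k - (Z i).card - τ i) :=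
          Finset.sum_congr rfl fun i hi => by
            simp only [Function.update_of_ne (Finset.ne_of_mem_erase hi)]
        rw [hcongr]
        simp only [Function.update_self]
        omega
      · have hne : ∀ i ∈ I', i ≠ i₀ := fun i hi h => hi₀' (h ▸ hi)
        have hE : I' ⊆ R := fun i hi =>
          (Finset.mem_sdiff.1 (Finset.mem_of_mem_insert_of_ne (hI' hi) (hne i hi))).1
        have := hc I' hE hI'ne W' t' fun i hi => by
          simpa [Function.update_of_ne (hne i hi)] using hb i hi
        refine le_trans (le_of_eq ?_) this
        congr 2
        exact Finset.sum_congr rfl fun i hi => by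
          simp only [Function.update_of_ne (hne i hi)]
    · intro i hi
      rcases eq_or_ne i i₀ with rfl | hne
      · simp only [Function.update_self]
        exact IsVanishingRow.sum fun i hi =>
          (hf i (hIR.1 hi)).mono (hWt i hi).1 (hWt i hi).2
      · simp only [Function.update_of_ne hne]
        exact hf i (Finset.mem_sdiff.1 (Finset.mem_of_mem_insert_of_ne hi hne)).1
    · rw [Finset.sum_insert hmem, Function.update_self,
        Finset.sum_congr rfl fun i hi =>
          Function.update_of_ne (ne_of_mem_of_not_mem hi hmem) _ f, add_comm,
        Finset.sum_sdiff hIR.1, hsum]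
  push Not at htight
  obtain ⟨i₀, hi₀, hmin⟩ := Finset.exists_min_image R τ hR
  by_cases hsub : ∀ i ∈ R, Z i ⊆ Z i₀
  · have hrow : f i₀ = 0 := by
      refine IsVanishingRow.eq_zero_of_le_card_add (Z := Z i₀) (τ := k - (Z i₀).card) he
        (by omega) ⟨fun s hs => ?_, (hf i₀ hi₀).2⟩
      have h := congrFun hsum s
      rw [← Finset.add_sum_erase _ _ hi₀, Pi.add_apply, Finset.sum_apply] at h
      rw [Finset.sum_eq_zero, add_zero] at h
      · exact h
      · intro i hi
        rw [Finset.mem_erase] at hi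
        have h2 := hc {i, i₀} (by simp [Finset.insert_subset_iff, hi.2, hi₀]) (by simp)
          (Z i) (τ i₀) (by simp [hsub i hi.2, hmin i hi.2])
        rw [Finset.sum_pair hi.1] at h2
        have := hd i hi.2
        have := hd i₀ hi₀
        exact (hf i hi.2).1 s (by omega)
    have hE := Finset.erase_subset i₀ R
    have hlt := Finset.card_erase_lt_of_mem hi₀
    have := ihR _ (by omega) (R.erase i₀) Z τ f (fun i hi => hd i (hE hi))
      (fun I hI => hc I (hI.trans hE)) (fun i hi => hf i (hE hi))
      (by rw [← Finset.add_sum_erase _ _ hi₀, hrow, zero_add] at hsum; exact hsum) rfl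
    intro i hi
    rcases eq_or_ne i i₀ with rfl | hne
    · exact hrow
    · exact this i (Finset.mem_erase.2 ⟨hne, hi⟩)
  · push Not at hsub
    obtain ⟨i₁, hi₁, hsub⟩ := hsub
    obtain ⟨j, hj₁, hj₀⟩ := Finset.not_subset.1 hsub
    by_contra! hne
    obtain ⟨i, hi, hne⟩ := hne
    obtain ⟨s, hs⟩ := Function.ne_iff.1 hne
    obtain ⟨D, hD, p, hp, hDp⟩ := IsVanishingRow.exists_degree_bound j
      (R ×ˢ Finset.range k) (fun p => f p.1 p.2) ⟨(i, s), by
        simp only [Finset.mem_product, Finset.mem_range]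
        refine ⟨hi, ?_⟩
        by_contra h
        exact hs ((hf i hi).1 s (by omega)), hs⟩
    rw [Finset.mem_product] at hp
    have hdeg : ∀ i ∈ R, ((Z i).erase j).card + (τ i + if j ∈ Z i then 1 else 0) =
        (Z i).card + τ i := by
      intro i hi
      split_ifs with h
      · have := Finset.card_erase_add_one h
        omega
      · rw [Finset.erase_eq_of_notMem h]
        rfl
    refine hDp (congrFun (ihZ _ ?_ (fun i => (Z i).erase j)
      (fun i => τ i + if j ∈ Z i then 1 else 0) (fun i s => degComp j D (f i s)) ?_ ?_ ?_ ?_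
      rfl p.1 hp.1) p.2)
    · rw [← hM]
      refine Finset.sum_lt_sum (fun i _ => Finset.card_le_card (Finset.erase_subset _ _))
        ⟨i₁, hi₁, Finset.card_erase_lt_of_mem hj₁⟩
    · intro i hi
      rw [hdeg i hi]
      exact hd i hi
    · intro I hI hIne W t hb
      have hb' : ∀ i ∈ I, W ⊆ Z i ∧ t - 1 ≤ τ i := fun i hi => by
        refine ⟨(hb i hi).1.trans (Finset.erase_subset _ _), ?_⟩
        have := (hb i hi).2
        split_ifs at this <;> omega
      have hcongr : ∑ i ∈ I, (k - ((Z i).erase j).card - (τ i + if j ∈ Z i then 1 else 0)) =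
          ∑ i ∈ I, (k - (Z i).card - τ i) := Finset.sum_congr rfl fun i hi => by
        have := hdeg i (hI hi)
        omega
      rw [hcongr]
      by_cases hi₀I : i₀ ∈ I ∧ ∀ i ∈ I, τ i₀ ≤ τ i
      · refine hc I hI hIne W t fun i hi => ⟨(hb' i hi).1, ?_⟩
        have := (hb i₀ hi₀I.1).2
        rw [if_neg hj₀] at this
        have := hi₀I.2 i hi
        omega
      · have hss : I ⊂ R := Finset.ssubset_iff_subset_ne.2 ⟨hI, fun h => hi₀I
          (by subst h; exact ⟨hi₀, hmin⟩)⟩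
        by_cases h2 : 2 ≤ I.card
        · have h3 := htight I hss h2 W (t - 1) hb'
          have := hc I hI hIne W (t - 1) hb'
          omega
        · obtain ⟨i, rfl⟩ := Finset.card_eq_one.1
            (by have := Finset.card_pos.2 hIne; omega : I.card = 1)
          have hb1 := hb i (Finset.mem_singleton_self i)
          have h1 := Finset.card_le_card hb1.1
          have h2 := hb1.2
          have h3 := hdeg i (hI (Finset.mem_singleton_self i))
          have h4 := hd i (hI (Finset.mem_singleton_self i))
          rw [Finset.sum_singleton]
          omega
    · intro i hi
      refine (hf i hi).degComp_erase he fun s d hd => ?_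
      by_cases hs : s < k
      · exact hD (i, s) (Finset.mem_product.2 ⟨hi, Finset.mem_range.2 hs⟩) d hd
      · exact absurd (by simp [(hf i hi).1 s (by omega)]) hd
    · funext s
      have := congrFun hsum s
      rw [Finset.sum_apply] at this ⊢
      rw [← map_sum, this, Pi.zero_apply, map_zero]

/-- Zero patterns satisfying the GM–MDS condition can be enlarged to maximal size. -/
theorem exists_enlarged_zero_pattern {J : Type*} [Fintype J] [DecidableEq J] {k : ℕ}
    (hk : k ≤ Fintype.card J) (Z : Fin k → Finset J)
    (hZ : ∀ Ω : Finset (Fin k), Ω.Nonempty → (Ω.inf Z).card + Ω.card ≤ k) :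
    ∃ Z' : Fin k → Finset J, (∀ i, Z i ⊆ Z' i) ∧ (∀ i, (Z' i).card + 1 = k) ∧
      ∀ Ω : Finset (Fin k), Ω.Nonempty → (Ω.inf Z').card + Ω.card ≤ k := by
  obtain ⟨Z', hZZ', hmax⟩ := (Set.toFinite {Z : Fin k → Finset J |
    ∀ Ω : Finset (Fin k), Ω.Nonempty → (Ω.inf Z).card + Ω.card ≤ k}).exists_le_maximal hZ
  have hc : ∀ Ω : Finset (Fin k), Ω.Nonempty → (Ω.inf Z').card + Ω.card ≤ k := hmax.1
  refine ⟨Z', hZZ', fun i => ?_, hc⟩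
  have hi := hc {i} (Finset.singleton_nonempty i)
  simp only [Finset.inf_singleton, Finset.card_singleton] at hi
  by_contra hne
  have hblock : ∀ j ∉ Z' i, ∃ Ω : Finset (Fin k), i ∈ Ω ∧ (Ω.inf Z').card + Ω.card = k ∧
      ∀ i' ∈ Ω, i' ≠ i → j ∈ Z' i' := by
    intro j hj
    have hle : Z' ≤ Function.update Z' i (insert j (Z' i)) := by
      rw [le_update_iff]
      exact ⟨Finset.subset_insert _ _, fun _ _ => le_rfl⟩
    have hnot : ¬ ∀ Ω : Finset (Fin k), Ω.Nonempty →
        (Ω.inf (Function.update Z' i (insert j (Z' i)))).card + Ω.card ≤ k := by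
      intro h
      have := hmax.2 h hle i
      rw [Function.update_self] at this
      exact hj (this (Finset.mem_insert_self _ _))
    push Not at hnot
    obtain ⟨Ω, hΩ, hgt⟩ := hnot
    have hsub : Ω.inf (Function.update Z' i (insert j (Z' i))) ⊆ insert j (Ω.inf Z') := by
      intro j' hj'
      rw [Finset.mem_insert]
      by_contra! h
      refine h.2 (Finset.mem_inf.2 fun i' hi' => ?_)
      have := Finset.mem_inf.1 hj' i' hi'
      rcases eq_or_ne i' i with rfl | hne
      · rw [Function.update_self] at this
        exact Finset.mem_of_mem_insert_of_ne this h.1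
      · rwa [Function.update_of_ne hne] at this
    have h1 := Finset.card_le_card hsub
    have h2 := Finset.card_insert_le j (Ω.inf Z')
    have h3 := hc Ω hΩ
    have hjmem : j ∈ Ω.inf (Function.update Z' i (insert j (Z' i))) := by
      by_contra h
      have := Finset.card_le_card ((Finset.subset_insert_iff_of_notMem h).1 hsub)
      omega
    refine ⟨Ω, ?_, by omega, fun i' hi' hne => ?_⟩
    · by_contra hiΩ
      rw [Finset.inf_congr rfl fun i' hi' =>
        Function.update_of_ne (ne_of_mem_of_not_mem hi' hiΩ) _ Z'] at hgt
      omega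
    · simpa [Function.update_of_ne hne] using Finset.mem_inf.1 hjmem i' hi'
  obtain ⟨j₀, -, hj₀⟩ := Finset.exists_mem_notMem_of_card_lt_card
    (s := Z' i) (t := Finset.univ) (by rw [Finset.card_univ]; omega)
  obtain ⟨Ω₁, hiΩ₁, hΩ₁, -⟩ := hblock j₀ hj₀
  obtain ⟨Ω, hΩ, hmin⟩ := Finset.exists_min_image
    (Finset.univ.filter fun Ω : Finset (Fin k) => i ∈ Ω ∧ (Ω.inf Z').card + Ω.card = k)
    Finset.card ⟨Ω₁, by simp [hiΩ₁, hΩ₁]⟩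
  simp only [Finset.mem_filter, Finset.mem_univ, true_and] at hΩ hmin
  have hcover : ∀ j ∉ Z' i, ∀ i' ∈ Ω, i' ≠ i → j ∈ Z' i' := by
    intro j hj i' hi' hne
    obtain ⟨B, hiB, hB, hjB⟩ := hblock j hj
    refine hjB i' ?_ hne
    have hun := hc (Ω ∪ B) ⟨i, Finset.mem_union_left _ hΩ.1⟩
    have hin := hc (Ω ∩ B) ⟨i, Finset.mem_inter.2 ⟨hΩ.1, hiB⟩⟩
    have h1 : Ω.inf Z' ∪ B.inf Z' ⊆ (Ω ∩ B).inf Z' := Finset.union_subset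
      (Finset.inf_mono Finset.inter_subset_left) (Finset.inf_mono Finset.inter_subset_right)
    have h2 := Finset.card_le_card h1
    have h3 := Finset.card_union_add_card_inter (Ω.inf Z') (B.inf Z')
    have h4 := Finset.card_union_add_card_inter Ω B
    rw [Finset.inf_union, Finset.inf_eq_inter] at hun
    have h5 := hmin (Ω ∩ B) ⟨Finset.mem_inter.2 ⟨hΩ.1, hiB⟩, by omega⟩
    have h6 := Finset.eq_of_subset_of_card_le Finset.inter_subset_left h5
    exact (Finset.mem_inter.1 (h6.symm.subset hi')).2
  by_cases hE : (Ω.erase i).Nonempty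
  · have h1 := hc _ hE
    have h2 : (Finset.univ \ Z' i) ∪ Ω.inf Z' ⊆ (Ω.erase i).inf Z' := by
      refine Finset.union_subset (fun j hj => Finset.mem_inf.2 fun i' hi' => ?_)
        (Finset.inf_mono (Finset.erase_subset _ _))
      rw [Finset.mem_erase] at hi'
      exact hcover j (Finset.mem_sdiff.1 hj).2 i' hi'.2 hi'.1
    have h3 := Finset.card_le_card h2
    have h4 : Disjoint (Finset.univ \ Z' i) (Ω.inf Z') :=
      Finset.disjoint_of_subset_right (Finset.inf_le hΩ.1) Finset.sdiff_disjoint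
    rw [Finset.card_union_of_disjoint h4, Finset.card_univ_sdiff] at h3
    have h5 := Finset.card_erase_add_one hΩ.1
    have h6 := Finset.card_le_univ (Z' i)
    omega
  · rw [Finset.not_nonempty_iff_eq_empty, Finset.erase_eq_empty_iff] at hE
    rcases hE with h | h
    · simp [h] at hΩ
    · have := hΩ.2
      simp only [h, Finset.inf_singleton, Finset.card_singleton] at this
      exact hne this

/-- The signed maximal minors of a `κ × (κ + 1)` matrix. -/
def cofactorRow {A : Type*} [CommRing A] {κ : ℕ} (g : Fin κ → Fin (κ + 1) → A)
    (s : Fin (κ + 1)) : A :=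
  (-1) ^ (s : ℕ) * (Matrix.of fun t r => g t (s.succAbove r)).det

theorem sum_cofactorRow_mul {A : Type*} [CommRing A] {κ : ℕ} (g : Fin κ → Fin (κ + 1) → A)
    (v : Fin (κ + 1) → A) :
    ∑ s, cofactorRow g s * v s = (Matrix.of (Fin.cons v g : Fin (κ + 1) → _)).det := by
  rw [Matrix.det_succ_row_zero]
  refine Finset.sum_congr rfl fun s _ => ?_
  rw [cofactorRow, mul_right_comm]
  rfl

theorem sum_cofactorRow_mul_self {A : Type*} [CommRing A] {κ : ℕ}
    (g : Fin κ → Fin (κ + 1) → A) (t : Fin κ) : ∑ s, cofactorRow g s * g t s = 0 := by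
  rw [sum_cofactorRow_mul]
  exact Matrix.det_zero_of_row_eq (i := 0) (j := t.succ) (Fin.succ_ne_zero t).symm rfl

theorem map_cofactorRow {A B : Type*} [CommRing A] [CommRing B] (φ : A →+* B) {κ : ℕ}
    (g : Fin κ → Fin (κ + 1) → A) (s : Fin (κ + 1)) :
    φ (cofactorRow g s) = cofactorRow (fun t r => φ (g t r)) s := by
  simp only [cofactorRow, map_mul, map_pow, map_neg, map_one, RingHom.map_det]
  rfl

theorem cofactorRow_mul_left {A : Type*} [CommRing A] {κ : ℕ} (v : Fin κ → A)
    (g : Fin κ → Fin (κ + 1) → A) (s : Fin (κ + 1)) :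
    cofactorRow (fun t r => v t * g t r) s = (∏ t, v t) * cofactorRow g s := by
  have := Matrix.det_mul_column v (Matrix.of fun t r => g t (s.succAbove r))
  simp only [Matrix.of_apply] at this
  rw [cofactorRow, this, cofactorRow]
  ring

/-- Row `i` holds the signed maximal minors of the Moore-like matrix with nodes `x (z i t)`. -/
def minorMatrix {A J ι : Type*} [CommRing A] {κ : ℕ} (e : ℕ → ℕ) (z : ι → Fin κ → J)
    (x : J → A) : Matrix ι (Fin (κ + 1)) A :=
  Matrix.of fun i => cofactorRow fun t r => x (z i t) ^ e r

theorem minorMatrix_map {A B J ι : Type*} [CommRing A] [CommRing B] {κ : ℕ} (e : ℕ → ℕ)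
    (z : ι → Fin κ → J) (x : J → A) (φ : A →+* B) :
    (minorMatrix e z x).map φ = minorMatrix e z (φ ∘ x) := by
  ext i s
  simp [minorMatrix, map_cofactorRow]

theorem sum_minorMatrix_mul {A J ι : Type*} [CommRing A] {κ : ℕ} (e : ℕ → ℕ)
    (z : ι → Fin κ → J) (x : J → A) (i : ι) (t : Fin κ) :
    ∑ s, minorMatrix e z x i s * x (z i t) ^ e s = 0 :=
  sum_cofactorRow_mul_self (fun t (r : Fin (κ + 1)) => x (z i t) ^ e r) t

theorem det_generic_ne_zero {F J : Type*} [CommRing F] [IsDomain F] {κ : ℕ} {e : ℕ → ℕ}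
    (he : StrictMono e) {z : Fin κ → J} (hz : Function.Injective z) :
    (Matrix.of fun t r : Fin κ => (MvPolynomial.X (z t) : MvPolynomial J F) ^ e r).det ≠ 0 := by
  classical
  intro h
  obtain ⟨v, hv, h0⟩ := Matrix.exists_mulVec_eq_zero_iff.2 h
  refine hv (funext fun r => ?_)
  have hrow : IsVanishingRow e κ (Finset.univ.map ⟨z, hz⟩) 0
      (fun s => if h : s < κ then v ⟨s, h⟩ else 0) := by
    refine ⟨fun s hs => dif_neg (by omega), fun j hj => ?_⟩
    obtain ⟨t, -, rfl⟩ := Finset.mem_map.1 hj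
    have := congrFun h0 t
    rw [Finset.sum_range]
    simpa [Matrix.mulVec, dotProduct, mul_comm] using this
  simpa using congrFun (hrow.eq_zero_of_le_card_add he (by simp)) r

theorem det_minorMatrix_generic_ne_zero {F J : Type*} [CommRing F] [IsDomain F] [Fintype J]
    [DecidableEq J] {κ : ℕ} {e : ℕ → ℕ} (he : StrictMono e) {z : Fin (κ + 1) → Fin κ → J}
    (hz : ∀ i, Function.Injective (z i))
    (hc : ∀ Ω : Finset (Fin (κ + 1)), Ω.Nonempty →
      (Ω.inf fun i => Finset.univ.image (z i)).card + Ω.card ≤ κ + 1) :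
    (minorMatrix e z (MvPolynomial.X : J → MvPolynomial J F)).det ≠ 0 := by
  intro h
  obtain ⟨v, hv, h0⟩ := Matrix.exists_vecMul_eq_zero_iff.2 h
  have hcard : ∀ i, (Finset.univ.image (z i)).card = κ := fun i => by
    rw [Finset.card_image_of_injective _ (hz i), Finset.card_univ, Fintype.card_fin]
  have key := IsVanishingRow.eq_zero_of_sum_eq_zero (k := κ + 1) he Finset.univ
    (fun i => Finset.univ.image (z i)) (fun _ => 0)
    (fun i s => if h : s < κ + 1 then
      v i * minorMatrix e z (MvPolynomial.X : J → MvPolynomial J F) i ⟨s, h⟩ else 0)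
    (fun i _ => by simp [hcard]) ?_ ?_ ?_
  · obtain ⟨i, hi⟩ := Function.ne_iff.1 hv
    have := congrFun (key i (Finset.mem_univ i)) κ
    rw [dif_pos (Nat.lt_succ_self κ)] at this
    rcases mul_eq_zero.1 this with h1 | h1
    · exact hi h1
    · refine det_generic_ne_zero (F := F) he (hz i) ?_
      have h2 : (⟨κ, Nat.lt_succ_self κ⟩ : Fin (κ + 1)) = Fin.last κ := rfl
      rw [h2, minorMatrix, Matrix.of_apply, cofactorRow] at h1
      rcases mul_eq_zero.1 h1 with h3 | h3
      · exact absurd h3 (pow_ne_zero _ (neg_ne_zero.2 one_ne_zero))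
      · simpa using h3
  · intro I _ hI W t hb
    have h1 := hc I hI
    have h2 : W.card ≤ _ :=
      Finset.card_le_card (Finset.le_inf fun i hi => (hb i hi).1 : W ≤ I.inf _)
    obtain ⟨i, hi⟩ := hI
    have h3 := (hb i hi).2
    simp only [hcard, Nat.sub_zero, Nat.add_sub_cancel_left, Finset.sum_const, smul_eq_mul,
      mul_one]
    omega
  · intro i _
    refine ⟨fun s hs => dif_neg (by omega), fun j hj => ?_⟩
    obtain ⟨t, -, rfl⟩ := Finset.mem_image.1 hj
    rw [Finset.sum_range]
    simp only [Fin.is_lt, dif_pos, mul_assoc, ← Finset.mul_sum]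
    rw [sum_minorMatrix_mul, mul_zero]
  · funext s
    rw [Finset.sum_apply, Pi.zero_apply]
    split_ifs with hs
    · exact congrFun h0 ⟨s, hs⟩
    · simp

/-- The properties of a degree function that bound the degree of a determinant. -/
structure IsDegreeLike {A : Type*} [CommRing A] (d : A → ℕ) : Prop where
  zero : d 0 = 0
  one : d 1 = 0
  neg (x : A) : d (-x) = d x
  add_le (x y : A) : d (x + y) ≤ max (d x) (d y)
  mul_le (x y : A) : d (x * y) ≤ d x + d y

namespace IsDegreeLike

variable {A : Type*} [CommRing A] {d : A → ℕ}

theorem sum_le (hd : IsDegreeLike d) {ι : Type*} (S : Finset ι) (f : ι → A) {N : ℕ}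
    (h : ∀ i ∈ S, d (f i) ≤ N) : d (∑ i ∈ S, f i) ≤ N :=
  Finset.sum_induction f (fun x => d x ≤ N)
    (fun x y hx hy => (hd.add_le x y).trans (max_le hx hy)) (by simp [hd.zero]) h

theorem prod_le (hd : IsDegreeLike d) {ι : Type*} (S : Finset ι) (f : ι → A) :
    d (∏ i ∈ S, f i) ≤ ∑ i ∈ S, d (f i) := by
  classical
  induction S using Finset.induction_on with
  | empty => simp [hd.one]
  | insert i S hi ih =>
    rw [Finset.prod_insert hi, Finset.sum_insert hi]
    exact (hd.mul_le _ _).trans (Nat.add_le_add_left ih _)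

theorem pow_le (hd : IsDegreeLike d) (x : A) (n : ℕ) : d (x ^ n) ≤ n * d x := by
  simpa using hd.prod_le (Finset.range n) fun _ => x

theorem det_le (hd : IsDegreeLike d) {n : ℕ} (M : Matrix (Fin n) (Fin n) A) (b : Fin n → ℕ)
    (h : ∀ i s, d (M i s) ≤ b i) : d M.det ≤ ∑ i, b i := by
  rw [Matrix.det_apply]
  refine hd.sum_le _ _ fun σ _ => ?_
  have h1 : d (Equiv.Perm.sign σ • ∏ i, M (σ i) i) = d (∏ i, M (σ i) i) := by
    rcases Int.units_eq_one_or (Equiv.Perm.sign σ) with h | h <;> simp [h, hd.neg]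
  rw [h1, ← Equiv.sum_comp σ b]
  exact (hd.prod_le _ _).trans (Finset.sum_le_sum fun i _ => h _ _)

theorem cofactorRow_le (hd : IsDegreeLike d) {κ : ℕ} (g : Fin κ → Fin (κ + 1) → A)
    (b : Fin κ → ℕ) (h : ∀ t r, d (g t r) ≤ b t) (s : Fin (κ + 1)) :
    d (cofactorRow g s) ≤ ∑ t, b t := by
  have h1 : d (cofactorRow g s) = d (Matrix.of fun t r => g t (s.succAbove r)).det := by
    rcases neg_one_pow_eq_or A (s : ℕ) with h | h <;> simp [cofactorRow, h, hd.neg]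
  rw [h1]
  exact hd.det_le _ b fun t r => h _ _

theorem minorMatrix_le (hd : IsDegreeLike d) {J ι : Type*} [DecidableEq J] {κ : ℕ}
    {e : ℕ → ℕ} (he : StrictMono e) {z : ι → Fin κ → J} {i : ι}
    (hz : Function.Injective (z i)) (x : J → A) (j : J)
    (hx : ∀ j', d (x j') ≤ if j' = j then 1 else 0)
    (s : Fin (κ + 1)) :
    d (minorMatrix e z x i s) ≤ if j ∈ Finset.univ.image (z i) then e κ else 0 := by
  have h1 := hd.cofactorRow_le (fun t (r : Fin (κ + 1)) => x (z i t) ^ e r)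
    (fun t => if z i t = j then e κ else 0) (fun t r => by
      refine (hd.pow_le _ _).trans ((Nat.mul_le_mul_left _ (hx _)).trans ?_)
      split_ifs
      · rw [mul_one]
        exact he.monotone (Nat.lt_succ_iff.1 r.2)
      · simp) s
  refine h1.trans ?_
  rw [← Finset.sum_image (f := fun j' => if j' = j then e κ else 0) hz.injOn,
    Finset.sum_ite_eq']

end IsDegreeLike

theorem isDegreeLike_natDegree {A : Type*} [CommRing A] :
    IsDegreeLike (Polynomial.natDegree : Polynomial A → ℕ) :=
  ⟨Polynomial.natDegree_zero, Polynomial.natDegree_one, Polynomial.natDegree_neg,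
    Polynomial.natDegree_add_le, fun _ _ => Polynomial.natDegree_mul_le⟩

theorem isDegreeLike_degreeOf {J A : Type*} [CommRing A] (j : J) :
    IsDegreeLike (MvPolynomial.degreeOf j : MvPolynomial J A → ℕ) :=
  ⟨MvPolynomial.degreeOf_zero j, MvPolynomial.degreeOf_one j, MvPolynomial.degreeOf_neg j,
    MvPolynomial.degreeOf_add_le j, MvPolynomial.degreeOf_mul_le j⟩

theorem sum_ite_mem_image_le {J : Type*} [Fintype J] [DecidableEq J] {κ : ℕ}
    {z : Fin (κ + 1) → Fin κ → J}
    (hc : ∀ Ω : Finset (Fin (κ + 1)), Ω.Nonempty →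
      (Ω.inf fun i => Finset.univ.image (z i)).card + Ω.card ≤ κ + 1) (j : J) (N : ℕ) :
    ∑ i, (if j ∈ Finset.univ.image (z i) then N else 0) ≤ κ * N := by
  rw [← Finset.sum_filter, Finset.sum_const, smul_eq_mul]
  refine Nat.mul_le_mul_right _ ?_
  rcases (Finset.univ.filter fun i => j ∈ Finset.univ.image (z i)).eq_empty_or_nonempty
    with h | h
  · rw [h]
    simp
  · have h1 := hc _ h
    have h2 : 0 < ((Finset.univ.filter fun i => j ∈ Finset.univ.image (z i)).inf
        fun i => Finset.univ.image (z i)).card :=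
      Finset.card_pos.2 ⟨j, Finset.mem_inf.2 fun i hi => (Finset.mem_filter.1 hi).2⟩
    omega

theorem exists_det_minorMatrix_ne_zero {L J : Type*} [Field L] [Fintype J]
    [DecidableEq J] {κ : ℕ} {e : ℕ → ℕ} (he : StrictMono e) {z : Fin (κ + 1) → Fin κ → J}
    (hz : ∀ i, Function.Injective (z i))
    (hc : ∀ Ω : Finset (Fin (κ + 1)), Ω.Nonempty →
      (Ω.inf fun i => Finset.univ.image (z i)).card + Ω.card ≤ κ + 1)
    (S : J → Finset L) (hS : ∀ j, κ * e κ < (S j).card) :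
    ∃ x : J → L, (∀ j, x j ∈ S j) ∧ (minorMatrix e z x).det ≠ 0 := by
  by_contra! h
  refine det_minorMatrix_generic_ne_zero (F := L) he hz hc
    (MvPolynomial.eq_zero_of_eval_zero_at_prod_finset _ S (fun j => ?_) fun x hx => ?_)
  · refine lt_of_le_of_lt ?_ (hS j)
    refine le_trans ?_ (sum_ite_mem_image_le hc j (e κ))
    refine (isDegreeLike_degreeOf j).det_le _ _ fun i s =>
      (isDegreeLike_degreeOf j).minorMatrix_le he (hz i) _ j (fun j' => ?_) s
    rw [MvPolynomial.degreeOf_X]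
    simp [eq_comm]
  · rw [RingHom.map_det, RingHom.mapMatrix_apply, minorMatrix_map]
    have : ⇑(MvPolynomial.eval x) ∘ MvPolynomial.X = x := funext fun j => by simp
    rw [this]
    exact h x hx

theorem sum_smul_pow_card_pow {Fq L ι : Type*} [Field Fq] [Fintype Fq] [Field L] [Algebra Fq L]
    (S : Finset ι) (a : ι → Fq) (x : ι → L) (r : ℕ) :
    (∑ i ∈ S, a i • x i) ^ Fintype.card Fq ^ r =
      ∑ i ∈ S, a i • x i ^ Fintype.card Fq ^ r := by
  have h : ∀ y : L, y ^ Fintype.card Fq ^ r = (FiniteField.frobeniusAlgHom Fq L ^ r) y := by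
    intro y
    rw [AlgHom.coe_pow, FiniteField.coe_frobeniusAlgHom, pow_iterate]
  simp only [h, map_sum, map_smul]

theorem linearIndependent_of_minorMatrix_ne_zero {Fq L J ι : Type*} [Field Fq] [Fintype Fq]
    [Field L] [Algebra Fq L] {κ : ℕ} {z : ι → Fin κ → J} {x : J → L} {i : ι} {s : Fin (κ + 1)}
    (h : minorMatrix (fun r => Fintype.card Fq ^ r) z x i s ≠ 0) :
    LinearIndependent Fq (fun t => x (z i t)) := by
  rw [Fintype.linearIndependent_iff]
  intro a ha t
  have hdet : (Matrix.of fun t r : Fin κ =>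
      x (z i t) ^ Fintype.card Fq ^ (s.succAbove r : ℕ)).det ≠ 0 :=
    fun h0 => h (by
      rw [minorMatrix, Matrix.of_apply, cofactorRow]
      exact mul_eq_zero_of_right _ h0)
  have h1 := Matrix.eq_zero_of_vecMul_eq_zero hdet (v := fun t => algebraMap Fq L (a t))
    (funext fun r => by
      have := sum_smul_pow_card_pow Finset.univ a (fun t => x (z i t)) (s.succAbove r : ℕ)
      rw [ha, zero_pow (pow_ne_zero _ Fintype.card_ne_zero)] at this
      simpa [Matrix.vecMul, dotProduct, Algebra.smul_def] using this.symm)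
  exact (map_eq_zero _).1 (congrFun h1 t)

/-- A node can be replaced by one of many candidates outside the span of the other nodes. -/
theorem exists_det_minorMatrix_update_ne_zero {Fq L J : Type*} [Field Fq] [Fintype Fq]
    [Field L] [Algebra Fq L] [Fintype J] [DecidableEq J] {κ : ℕ}
    {z : Fin (κ + 1) → Fin κ → J} (hz : ∀ i, Function.Injective (z i))
    (hc : ∀ Ω : Finset (Fin (κ + 1)), Ω.Nonempty →
      (Ω.inf fun i => Finset.univ.image (z i)).card + Ω.card ≤ κ + 1)
    {x : J → L} (hx : (minorMatrix (fun r => Fintype.card Fq ^ r) z x).det ≠ 0) (j : J)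
    (D : Finset L) (hD : ∀ y ∈ D, y ∉ Submodule.span Fq (x '' {j}ᶜ))
    (hcard : κ * (Fintype.card Fq ^ κ - Fintype.card Fq ^ (κ - 1)) < D.card) :
    ∃ y ∈ D,
      (minorMatrix (fun r => Fintype.card Fq ^ r) z (Function.update x j y)).det ≠ 0 := by
  classical
  set e : ℕ → ℕ := fun r => Fintype.card Fq ^ r with he_def
  have he : StrictMono e := fun a b h => Nat.pow_lt_pow_right Fintype.one_lt_card h
  set xp : J → Polynomial L := Function.update (fun j' => Polynomial.C (x j')) j Polynomial.X
    with hxp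
  have heval : ∀ y, ⇑(Polynomial.evalRingHom y) ∘ xp = Function.update x j y := by
    intro y
    funext j'
    rcases eq_or_ne j' j with rfl | h
    · simp [hxp]
    · simp [hxp, h]
  have hevalM : ∀ y i s, (minorMatrix e z xp i s).eval y =
      minorMatrix e z (Function.update x j y) i s := by
    intro y i s
    rw [← heval, ← minorMatrix_map]
    rfl
  have hevalDet : ∀ y, (minorMatrix e z xp).det.eval y =
      (minorMatrix e z (Function.update x j y)).det := by
    intro y
    rw [← heval, ← minorMatrix_map, ← RingHom.mapMatrix_apply, ← RingHom.map_det]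
    rfl
  have hrow : ∀ i, ∃ s, minorMatrix e z x i s ≠ 0 := by
    intro i
    by_contra! h
    exact hx (Matrix.det_eq_zero_of_row_eq_zero i h)
  have hfactor : ∀ i, ∃ p : Polynomial L, p.Monic ∧ (∀ y ∈ D, p.eval y ≠ 0) ∧
      ∀ s, ∃ r, minorMatrix e z xp i s = p * r ∧ r.natDegree ≤
        if j ∈ Finset.univ.image (z i) then e κ - e (κ - 1) else 0 := by
    intro i
    have hdeg := fun s => isDegreeLike_natDegree.minorMatrix_le he (hz i) xp j (fun j' => by
      rcases eq_or_ne j' j with rfl | h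
      · simp [hxp]
      · simp [hxp, h]) s
    by_cases hj : j ∈ Finset.univ.image (z i)
    swap
    · simp only [if_neg hj] at hdeg ⊢
      exact ⟨1, Polynomial.monic_one, fun _ _ => by simp, fun s => ⟨_, (one_mul _).symm, hdeg s⟩⟩
    simp only [if_pos hj] at hdeg ⊢
    obtain ⟨t₀, -, ht₀⟩ := Finset.mem_image.1 hj
    obtain ⟨s₀, hs₀⟩ := hrow i
    have hli := linearIndependent_of_minorMatrix_ne_zero hs₀
    have hli' : LinearIndependent Fq (fun t : {t // t ≠ t₀} => x (z i t)) :=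
      hli.comp _ Subtype.val_injective
    set U := Submodule.span Fq (Set.range fun t : {t // t ≠ t₀} => x (z i t)) with hU
    have hfd : Module.Finite Fq U := FiniteDimensional.span_of_finite Fq (Set.finite_range _)
    have hfin : Finite U := Module.finite_of_finite Fq
    have hUcard : Nat.card U = e (κ - 1) := by
      rw [Module.natCard_eq_pow_finrank (K := Fq), Nat.card_eq_fintype_card, hU,
        finrank_span_eq_card hli']
      simp [he_def]
    have hUfin : (U : Set L).Finite := Set.toFinite _
    have hUle : U ≤ Submodule.span Fq (x '' {j}ᶜ) := Submodule.span_mono (by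
      rintro _ ⟨t, rfl⟩
      exact ⟨_, fun h => t.2 (hz i (h.trans ht₀.symm)), rfl⟩)
    have hmonic : (∏ u ∈ hUfin.toFinset, (Polynomial.X - Polynomial.C u)).Monic :=
      Polynomial.monic_prod_of_monic _ _ fun u _ => Polynomial.monic_X_sub_C u
    have hpdeg : (∏ u ∈ hUfin.toFinset, (Polynomial.X - Polynomial.C u)).natDegree =
        e (κ - 1) := by
      rw [Polynomial.natDegree_prod_of_monic _ _ fun u _ => Polynomial.monic_X_sub_C u]
      simp only [Polynomial.natDegree_X_sub_C, Finset.sum_const, smul_eq_mul, mul_one]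
      rw [← hUcard, ← Set.ncard_eq_toFinset_card _ hUfin]
      rfl
    refine ⟨_, hmonic, fun y hy => ?_, fun s => ?_⟩
    · rw [Polynomial.eval_prod, Finset.prod_ne_zero_iff]
      intro u hu
      rw [Polynomial.eval_sub, Polynomial.eval_X, Polynomial.eval_C, sub_ne_zero]
      rintro rfl
      exact hD y hy (hUle ((Set.Finite.mem_toFinset hUfin).1 hu))
    · have hdvd : (∏ u ∈ hUfin.toFinset, (Polynomial.X - Polynomial.C u)) ∣
          minorMatrix e z xp i s := by
        refine Finset.prod_dvd_of_coprime (fun u _ v _ huv =>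
          Polynomial.pairwise_coprime_X_sub_C Function.injective_id huv) fun u hu => ?_
        rw [Polynomial.dvd_iff_isRoot, Polynomial.IsRoot, hevalM]
        by_contra hne
        have h1 := linearIndependent_of_minorMatrix_ne_zero hne
        have h2 := h1.notMem_span_image (s := {t₀}ᶜ) (x := t₀) (by simp)
        refine h2 ?_
        rw [ht₀, Function.update_self]
        have h3 : (fun t => Function.update x j u (z i t)) '' {t₀}ᶜ =
            Set.range fun t : {t // t ≠ t₀} => x (z i t) := by
          ext v
          simp only [Set.mem_image, Set.mem_compl_iff, Set.mem_singleton_iff, Set.mem_range,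
            Subtype.exists, exists_prop]
          refine exists_congr fun t => and_congr_right fun ht => ?_
          rw [Function.update_of_ne (fun h => ht (hz i (h.trans ht₀.symm)))]
        rw [h3]
        exact (Set.Finite.mem_toFinset hUfin).1 hu
      obtain ⟨r, hr⟩ := hdvd
      refine ⟨r, hr, ?_⟩
      by_cases hr0 : r = 0
      · simp [hr0]
      · have h1 := hdeg s
        rw [hr, hmonic.natDegree_mul' hr0, hpdeg] at h1
        omega
  choose p hp_monic hp_eval r hr using hfactor
  have hM : minorMatrix e z xp = Matrix.of fun i s => p i * (Matrix.of r) i s := by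
    ext1 i s
    exact (hr i s).1
  have hdet : (minorMatrix e z xp).det = (∏ i, p i) * (Matrix.of r).det := by
    rw [hM, Matrix.det_mul_column]
  have hr_ne : (Matrix.of r).det ≠ 0 := by
    intro h
    have := hevalDet (x j)
    rw [hdet, h, mul_zero, Polynomial.eval_zero, Function.update_eq_self] at this
    exact hx this.symm
  have hr_deg : (Matrix.of r).det.natDegree < D.card := by
    refine lt_of_le_of_lt ?_ hcard
    exact (isDegreeLike_natDegree.det_le _ _ fun i s => (hr i s).2).trans
      (sum_ite_mem_image_le hc j _)
  obtain ⟨y, hy, hy0⟩ : ∃ y ∈ D, (Matrix.of r).det.eval y ≠ 0 := by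
    by_contra! h
    exact hr_ne (Polynomial.eq_zero_of_natDegree_lt_card_of_eval_eq_zero' _ D h hr_deg)
  refine ⟨y, hy, ?_⟩
  rw [← hevalDet, hdet, Polynomial.eval_mul, Polynomial.eval_prod]
  exact mul_ne_zero (Finset.prod_ne_zero_iff.2 fun i _ => hp_eval i y hy) hy0

theorem mul_pow_sub_pow_lt {q κ m : ℕ} (hq : 2 ≤ q) (hm : 1 ≤ m)
    (h : (κ + 1) * q ^ κ ≤ q ^ m) : κ * (q ^ κ - q ^ (κ - 1)) < q ^ m - q ^ (m - 1) := by
  obtain ⟨m, rfl⟩ := Nat.exists_eq_add_of_le' hm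
  obtain ⟨q, rfl⟩ := Nat.exists_eq_add_of_le' hq
  have hpos : 0 < (q + 2) ^ m := by positivity
  have h2 : ∀ n, (q + 2) ^ (n + 1) - (q + 2) ^ n = (q + 2) ^ n * (q + 1) := fun n => by
    rw [pow_succ, ← Nat.mul_sub_one]
    rfl
  rw [Nat.add_sub_cancel, h2]
  rcases κ with _ | κ
  · rw [zero_mul]
    positivity
  · rw [Nat.add_sub_cancel, h2, ← mul_assoc]
    refine Nat.mul_lt_mul_of_pos_right ?_ (Nat.succ_pos q)
    rw [pow_succ, pow_succ, ← mul_assoc] at h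
    have h3 := Nat.le_of_mul_le_mul_right h (by omega)
    have hpos' : 0 < (q + 2) ^ κ := by positivity
    nlinarith

theorem mem_span_of_smul_mem_span {Fq K L I : Type*} [Field Fq] [Field K] [Algebra Fq K]
    [Field L] [Algebra K L] [Algebra Fq L] [IsScalarTower Fq K L] {N : I → Type*}
    {c : I → L} (hc : LinearIndependent K c) (b : (Σ l, N l) → K) (l : I) (t : N l) (y : K)
    (hy : y • c l ∈ Submodule.span Fq ((fun j => b j • c j.1) '' {⟨l, t⟩}ᶜ)) :
    y ∈ Submodule.span Fq ((fun t' => b ⟨l, t'⟩) '' {t}ᶜ) := by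
  classical
  obtain ⟨φ, hφ⟩ := LinearMap.exists_extend
    ((Finsupp.lapply l : (I →₀ K) →ₗ[K] K) ∘ₗ hc.repr)
  have hφc : ∀ l', φ (c l') = if l' = l then 1 else 0 := by
    intro l'
    have hmem : c l' ∈ Submodule.span K (Set.range c) := Submodule.subset_span ⟨l', rfl⟩
    have h1 := LinearMap.congr_fun hφ ⟨c l', hmem⟩
    simpa only [LinearMap.comp_apply, Submodule.subtype_apply,
      hc.repr_eq_single l' ⟨c l', hmem⟩ rfl, Finsupp.lapply_apply, Finsupp.single_apply] using h1
  have h1 : φ.restrictScalars Fq (y • c l) ∈ Submodule.map (φ.restrictScalars Fq)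
      (Submodule.span Fq ((fun j => b j • c j.1) '' {⟨l, t⟩}ᶜ)) := Submodule.mem_map_of_mem hy
  rw [Submodule.map_span] at h1
  have h2 : φ.restrictScalars Fq (y • c l) = y := by simp [hφc]
  rw [h2] at h1
  refine Submodule.span_le.2 ?_ h1
  rintro _ ⟨_, ⟨⟨l', t'⟩, hne, rfl⟩, rfl⟩
  rcases eq_or_ne l' l with rfl | hl
  · simp only [LinearMap.coe_restrictScalars, map_smul, hφc, if_true, smul_eq_mul, mul_one]
    refine Submodule.subset_span ⟨t', fun h => hne ?_, rfl⟩
    rw [Set.mem_singleton_iff] at h ⊢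
    rw [h]
  · simp [hφc, hl]

theorem exists_multipliers {Fq K L : Type*} [Field Fq] [Fintype Fq] [Field K] [Algebra Fq K]
    [Finite K] [Field L] [Algebra K L] [Algebra Fq L] [IsScalarTower Fq K L] {ℓ κ : ℕ}
    {nn : Fin ℓ → ℕ} (hnn : ∀ l, nn l ≤ Module.finrank Fq K)
    (hqm : (κ + 1) * Fintype.card Fq ^ κ ≤ Fintype.card Fq ^ Module.finrank Fq K)
    {z : Fin (κ + 1) → Fin κ → (l : Fin ℓ) × Fin (nn l)} (hz : ∀ i, Function.Injective (z i))
    (hcond : ∀ Ω : Finset (Fin (κ + 1)), Ω.Nonempty →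
      (Ω.inf fun i => Finset.univ.image (z i)).card + Ω.card ≤ κ + 1)
    {c : Fin ℓ → L} (hc : LinearIndependent K c) :
    ∃ b : ((l : Fin ℓ) × Fin (nn l)) → K,
      (∀ l, LinearIndependent Fq fun t => b ⟨l, t⟩) ∧
      (minorMatrix (fun r => Fintype.card Fq ^ r) z fun j => b j • c j.1).det ≠ 0 := by
  classical
  have := Fintype.ofFinite K
  have hcardK : Fintype.card K = Fintype.card Fq ^ Module.finrank Fq K :=
    Module.card_eq_pow_finrank
  have hinj : ∀ l, Function.Injective fun y : K => y • c l := fun l =>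
    smul_left_injective K (hc.ne_zero l)
  obtain ⟨x, hxS, hx⟩ := exists_det_minorMatrix_ne_zero
    (fun a b h => Nat.pow_lt_pow_right Fintype.one_lt_card h :
      StrictMono fun r => Fintype.card Fq ^ r) hz hcond
    (fun j => Finset.univ.image fun y : K => y • c j.1) (fun j => by
      rw [Finset.card_image_of_injective _ (hinj _), Finset.card_univ, hcardK]
      have : 0 < Fintype.card Fq ^ κ := pow_pos Fintype.card_pos _
      linarith)
  have hxb : ∀ j, ∃ y : K, y • c j.1 = x j := fun j => by simpa using hxS j
  choose b₀ hb₀ using hxb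
  have key : ∀ S : Finset ((l : Fin ℓ) × Fin (nn l)), ∃ b : ((l : Fin ℓ) × Fin (nn l)) → K,
      (∀ l, LinearIndepOn Fq (fun t => b ⟨l, t⟩) {t | (⟨l, t⟩ : (l : Fin ℓ) × Fin (nn l)) ∈ S}) ∧
      (minorMatrix (fun r => Fintype.card Fq ^ r) z fun j => b j • c j.1).det ≠ 0 := by
    intro S
    induction S using Finset.induction_on with
    | empty =>
      refine ⟨b₀, fun l => by simp, ?_⟩
      simp_rw [hb₀]
      exact hx
    | insert j S hjS ih =>
      obtain ⟨b, hb, hdet⟩ := ih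
      obtain ⟨l, t⟩ := j
      set V := Submodule.span Fq ((fun t' => b ⟨l, t'⟩) '' {t}ᶜ) with hV
      have hVrank : Module.finrank Fq V ≤ Module.finrank Fq K - 1 := by
        have h1 := finrank_span_finset_le_card (R := Fq)
          ((Finset.univ.erase t).image fun t' => b ⟨l, t'⟩)
        have h2 : (((Finset.univ.erase t).image fun t' => b ⟨l, t'⟩ : Finset K) : Set K) =
            (fun t' => b ⟨l, t'⟩) '' {t}ᶜ := by
          rw [Finset.coe_image, Finset.coe_erase, Finset.coe_univ, Set.compl_eq_univ_sdiff]
        rw [Set.finrank, h2] at h1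
        have h3 := (Finset.card_image_le (s := Finset.univ.erase t)
          (f := fun t' => b ⟨l, t'⟩))
        rw [Finset.card_erase_of_mem (Finset.mem_univ t), Finset.card_univ,
          Fintype.card_fin] at h3
        have h4 := hnn l
        exact h1.trans (h3.trans (by omega))
      have hVcard : (Finset.univ.filter fun y : K => y ∈ V).card ≤
          Fintype.card Fq ^ (Module.finrank Fq K - 1) := by
        have h1 : Nat.card V = Fintype.card Fq ^ Module.finrank Fq V := by
          rw [Module.natCard_eq_pow_finrank (K := Fq), Nat.card_eq_fintype_card]
        rw [← Fintype.card_subtype, ← Nat.card_eq_fintype_card]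
        exact h1.le.trans (Nat.pow_le_pow_right Fintype.card_pos hVrank)
      obtain ⟨_, hy, hdet'⟩ := exists_det_minorMatrix_update_ne_zero (Fq := Fq) hz hcond hdet
        ⟨l, t⟩ ((Finset.univ.filter fun y : K => y ∉ V).image fun y : K => y • c l) (by
          intro u hu
          obtain ⟨y, hy, rfl⟩ := Finset.mem_image.1 hu
          exact fun h => (Finset.mem_filter.1 hy).2 (mem_span_of_smul_mem_span hc b l t y h)) (by
          rw [Finset.card_image_of_injective _ (hinj _)]
          refine lt_of_lt_of_le (mul_pow_sub_pow_lt Fintype.one_lt_card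
            (le_trans (Nat.one_le_iff_ne_zero.2 (Nat.ne_of_gt (Fin.pos t))) (hnn l)) hqm) ?_
          have h1 := Finset.card_filter_add_card_filter_not (s := (Finset.univ : Finset K))
            (fun y => y ∈ V)
          rw [Finset.card_univ, hcardK] at h1
          omega)
      obtain ⟨y, hyV, rfl⟩ := Finset.mem_image.1 hy
      replace hyV := (Finset.mem_filter.1 hyV).2
      refine ⟨Function.update b ⟨l, t⟩ y, fun l' => ?_, ?_⟩
      · have hcongr : Set.EqOn (fun t' => b ⟨l', t'⟩)
            (fun t' => Function.update b ⟨l, t⟩ y ⟨l', t'⟩)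
            {t' | (⟨l', t'⟩ : (l : Fin ℓ) × Fin (nn l)) ∈ S} := fun t' ht' => by
          have hmem : (⟨l', t'⟩ : (l : Fin ℓ) × Fin (nn l)) ∈ S := ht'
          exact (Function.update_of_ne (ne_of_mem_of_not_mem hmem hjS) y b).symm
        have hold := (linearIndepOn_congr hcongr).1 (hb l')
        rcases eq_or_ne l' l with rfl | hl
        · have hset : {t' | (⟨l', t'⟩ : (l : Fin ℓ) × Fin (nn l)) ∈ insert ⟨l', t⟩ S} =
              insert t {t' | (⟨l', t'⟩ : (l : Fin ℓ) × Fin (nn l)) ∈ S} := by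
            ext t'
            simp
          rw [hset]
          refine hold.insert ?_
          rw [← hcongr.image_eq]
          have hself : Function.update b ⟨l', t⟩ y ⟨l', t⟩ = y :=
            Function.update_self (⟨l', t⟩ : (l : Fin ℓ) × Fin (nn l)) y b
          rw [hself]
          have hsub : {t' | (⟨l', t'⟩ : (l : Fin ℓ) × Fin (nn l)) ∈ S} ⊆ {t}ᶜ := by
            rintro t' ht' rfl
            exact hjS ht'
          exact Set.notMem_subset (Submodule.span_mono (Set.image_mono hsub)) hyV
        · have hset : {t' | (⟨l', t'⟩ : (l : Fin ℓ) × Fin (nn l)) ∈ insert ⟨l, t⟩ S} =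
              {t' | (⟨l', t'⟩ : (l : Fin ℓ) × Fin (nn l)) ∈ S} := by
            ext t'
            simp [hl]
          rwa [hset]
      · convert hdet' using 3
        funext j
        rcases eq_or_ne j ⟨l, t⟩ with rfl | hj
        · simp
        · simp [hj]
  obtain ⟨b, hb, hdet⟩ := key Finset.univ
  refine ⟨b, fun l => ?_, hdet⟩
  simpa [linearIndepOn_univ_iff] using hb l

/-- Pairwise non-conjugate block representatives `a l`, together with `K`-linearly independent
`(q - 1)`-th roots of them in an algebraically closed extension. -/
theorem exists_block_representatives {Fq K : Type*} (L : Type*) [Field Fq] [Fintype Fq] [Field K]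
    [Algebra Fq K] [Finite K] [Field L] [Algebra K L] [IsAlgClosed L] {ℓ : ℕ}
    (hℓ : ℓ + 1 ≤ Fintype.card Fq) :
    ∃ (a : Fin ℓ → K) (c : Fin ℓ → L), (∀ l, a l ≠ 0) ∧
      (∀ l l', l ≠ l' → ∀ u : K, u ≠ 0 → a l ≠ u ^ (Fintype.card Fq - 1) * a l') ∧
      (∀ l, c l ^ (Fintype.card Fq - 1) = algebraMap K L (a l)) ∧ LinearIndependent K c := by
  have := Fintype.ofFinite K
  have hq : 1 < Fintype.card Fq := Fintype.one_lt_card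
  have hK : 1 < Fintype.card K := Fintype.one_lt_card
  obtain ⟨N, hN⟩ : Fintype.card Fq - 1 ∣ Fintype.card K - 1 := by
    rw [Module.card_eq_pow_finrank (K := Fq) (V := K)]
    simpa using Nat.sub_dvd_pow_sub_pow (Fintype.card Fq) 1 (Module.finrank Fq K)
  have hNpos : 0 < N := Nat.pos_of_ne_zero fun h => by
    rw [h, mul_zero] at hN
    omega
  obtain ⟨γ, hγ⟩ := IsCyclic.exists_ofOrder_eq_natCard (α := Kˣ)
  rw [Nat.card_units, Nat.card_eq_fintype_card] at hγ
  have hμ : Function.Injective fun l : Fin ℓ => ((γ : K) ^ (l : ℕ)) ^ N := by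
    intro l l' h
    have hlt : ∀ l : Fin ℓ, (l : ℕ) * N ∈ Set.Iio (orderOf γ) := fun l => by
      rw [Set.mem_Iio, hγ, hN]
      exact Nat.mul_lt_mul_of_pos_right (by omega) hNpos
    have h1 : γ ^ ((l : ℕ) * N) = γ ^ ((l' : ℕ) * N) := by
      ext
      simpa [pow_mul] using h
    exact Fin.ext (Nat.eq_of_mul_eq_mul_right hNpos (pow_injOn_Iio_orderOf (hlt l) (hlt l') h1))
  have hroot : ∀ l : Fin ℓ, ∃ c : L,
      c ^ (Fintype.card Fq - 1) = algebraMap K L ((γ : K) ^ (l : ℕ)) := fun l =>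
    IsAlgClosed.exists_pow_nat_eq _ (by omega)
  choose c hc using hroot
  refine ⟨fun l => (γ : K) ^ (l : ℕ), c, fun l => pow_ne_zero _ γ.ne_zero, ?_, hc, ?_⟩
  · intro l l' hne u hu h
    refine hne (hμ ?_)
    simp only at h ⊢
    rw [h, mul_pow, ← pow_mul, ← hN, FiniteField.pow_card_sub_one_eq_one u hu, one_mul]
  · refine Module.End.eigenvectors_linearIndependent' (FiniteField.frobeniusAlgHom K L).toLinearMap
      (fun l : Fin ℓ => ((γ : K) ^ (l : ℕ)) ^ N) hμ c fun l => ?_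
    have hc0 : c l ≠ 0 := by
      intro h0
      have := hc l
      rw [h0, zero_pow (by omega), eq_comm, map_eq_zero] at this
      exact pow_ne_zero _ γ.ne_zero this
    refine ⟨Module.End.mem_eigenspace_iff.2 ?_, hc0⟩
    rw [AlgHom.toLinearMap_apply, FiniteField.frobeniusAlgHom_apply, Algebra.smul_def, map_pow,
      ← hc l, ← pow_mul, ← hN, ← pow_succ]
    congr 1
    omega

theorem linearIndependent_smul_sigma {Fq K L I : Type*} [Field Fq] [Field K] [Algebra Fq K]
    [Field L] [Algebra K L] [Algebra Fq L] [IsScalarTower Fq K L] [Fintype I] {N : I → Type*}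
    [∀ l, Fintype (N l)] {c : I → L} (hc : LinearIndependent K c) {b : (Σ l, N l) → K}
    (hb : ∀ l, LinearIndependent Fq fun t => b ⟨l, t⟩) :
    LinearIndependent Fq fun j => b j • c j.1 := by
  rw [Fintype.linearIndependent_iff]
  rintro g hg ⟨l, t⟩
  rw [Fintype.sum_sigma] at hg
  simp_rw [← smul_assoc, ← Finset.sum_smul] at hg
  exact Fintype.linearIndependent_iff.1 (hb l) _ (Fintype.linearIndependent_iff.1 hc _ hg l) t

theorem card_le_of_linearized_roots {Fq L : Type*} [Field Fq] [Fintype Fq] [Field L]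
    {κ : ℕ} {f : Fin (κ + 1) → L} (hf : f ≠ 0) (S : Finset L)
    (hS : ∀ u ∈ S, ∑ s, f s * u ^ Fintype.card Fq ^ (s : ℕ) = 0) :
    S.card ≤ Fintype.card Fq ^ κ := by
  have hq : 1 < Fintype.card Fq := Fintype.one_lt_card
  set F : Polynomial L := ∑ s : Fin (κ + 1),
    Polynomial.C (f s) * Polynomial.X ^ Fintype.card Fq ^ (s : ℕ) with hF
  obtain ⟨s₀, hs₀⟩ := Function.ne_iff.1 hf
  have hF0 : F ≠ 0 := by
    intro h
    have h1 := congrArg (fun p => p.coeff (Fintype.card Fq ^ (s₀ : ℕ))) h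
    simp only [hF, Polynomial.finsetSum_coeff, Polynomial.coeff_C_mul_X_pow,
      Polynomial.coeff_zero, Nat.pow_right_inj hq, Fin.val_inj] at h1
    rw [Finset.sum_ite_eq, if_pos (Finset.mem_univ _)] at h1
    exact hs₀ h1
  have hdeg : F.natDegree ≤ Fintype.card Fq ^ κ :=
    Polynomial.natDegree_sum_le_of_forall_le _ _ fun s _ =>
      (Polynomial.natDegree_C_mul_X_pow_le _ _).trans
        (Nat.pow_le_pow_right hq.le (Nat.lt_succ_iff.1 s.2))
  by_contra! h
  refine hF0 (Polynomial.eq_zero_of_natDegree_lt_card_of_eval_eq_zero' F S (fun u hu => ?_)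
    (hdeg.trans_lt h))
  simpa [hF, Polynomial.eval_finsetSum] using hS u hu

theorem le_sumRankWt_add {Fq K L : Type*} [Field Fq] [Fintype Fq] [Field K] [Algebra Fq K]
    [Field L] [Algebra K L] [Algebra Fq L] [IsScalarTower Fq K L] {ℓ κ : ℕ} {nn : Fin ℓ → ℕ}
    {c : Fin ℓ → L} (hc : LinearIndependent K c) {b : ((l : Fin ℓ) × Fin (nn l)) → K}
    (hb : ∀ l, LinearIndependent Fq fun t => b ⟨l, t⟩) {f : Fin (κ + 1) → K} (hf : f ≠ 0)
    {y : ((l : Fin ℓ) × Fin (nn l)) → K}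
    (hy : ∀ j, y j • c j.1 =
      ∑ s, algebraMap K L (f s) * (b j • c j.1) ^ Fintype.card Fq ^ (s : ℕ)) :
    ∑ l, nn l ≤ sumRankWt Fq y + κ := by
  classical
  set V : Fin ℓ → Submodule Fq K := fun l => Submodule.span Fq (Set.range fun t => y ⟨l, t⟩)
    with hV
  have hVfd : ∀ l, Module.Finite Fq (V l) := fun l =>
    FiniteDimensional.span_of_finite Fq (Set.finite_range _)
  set Ψ : (((l : Fin ℓ) × Fin (nn l)) → Fq) →ₗ[Fq] (∀ l, V l) :=
    LinearMap.pi fun l => LinearMap.codRestrict (V l)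
      (∑ t, (LinearMap.proj (⟨l, t⟩ : (l : Fin ℓ) × Fin (nn l))).smulRight (y ⟨l, t⟩))
      (fun v => by
        rw [LinearMap.sum_apply]
        exact Submodule.sum_mem _ fun t _ =>
          Submodule.smul_mem _ _ (Submodule.subset_span ⟨t, rfl⟩)) with hΨ
  have hker : ∀ v ∈ LinearMap.ker Ψ, ∀ l, ∑ t, v ⟨l, t⟩ • y ⟨l, t⟩ = 0 := by
    intro v hv l
    have := congrArg Subtype.val (congrFun (LinearMap.mem_ker.1 hv) l)
    simpa [hΨ] using this
  have hx := linearIndependent_smul_sigma hc hb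
  have hinj : Function.Injective fun v : LinearMap.ker Ψ => ∑ j, v.1 j • b j • c j.1 :=
    fun v w h => Subtype.ext (hx.fintypeLinearCombination_injective h)
  have hkerfin : Fintype (LinearMap.ker Ψ) := Fintype.ofFinite _
  have hkercard : Fintype.card (LinearMap.ker Ψ) ≤ Fintype.card Fq ^ κ := by
    rw [← Finset.card_univ, ← Finset.card_image_of_injective _ hinj]
    have hf' : (fun s => algebraMap K L (f s)) ≠ 0 := fun h => hf (funext fun s =>
      (map_eq_zero (algebraMap K L)).1 (congrFun h s))
    refine card_le_of_linearized_roots (Fq := Fq) hf' _ fun u hu => ?_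
    obtain ⟨v, -, rfl⟩ := Finset.mem_image.1 hu
    simp_rw [sum_smul_pow_card_pow, Finset.mul_sum, mul_smul_comm]
    rw [Finset.sum_comm]
    simp_rw [← Finset.smul_sum, ← hy]
    rw [Fintype.sum_sigma]
    refine Finset.sum_eq_zero fun l _ => ?_
    simp_rw [← smul_assoc, ← Finset.sum_smul]
    rw [hker v.1 v.2 l, zero_smul]
  rw [Module.card_eq_pow_finrank (K := Fq),
    Nat.pow_le_pow_iff_right Fintype.one_lt_card] at hkercard
  have h1 := LinearMap.finrank_range_add_finrank_ker Ψ
  rw [Module.finrank_fintype_fun_eq_card, Fintype.card_sigma] at h1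
  simp only [Fintype.card_fin] at h1
  have h2 : Module.finrank Fq (LinearMap.range Ψ) ≤ sumRankWt Fq y :=
    (Submodule.finrank_le _).trans (Module.finrank_pi_fintype Fq).le
  omega

theorem sumRankWt_add_card_le {Fq K : Type*} [Field Fq] [Field K] [Algebra Fq K] {ℓ : ℕ}
    {nn : Fin ℓ → ℕ} (y : ((l : Fin ℓ) × Fin (nn l)) → K)
    (S : Finset ((l : Fin ℓ) × Fin (nn l))) (hS : ∀ j ∈ S, y j = 0) :
    sumRankWt Fq y + S.card ≤ ∑ l, nn l := by
  classical
  have h1 : ∀ l, rankFq Fq (fun t => y ⟨l, t⟩) ≤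
      (Finset.univ.filter fun t => (⟨l, t⟩ : (l : Fin ℓ) × Fin (nn l)) ∉ S).card := by
    intro l
    set A := Finset.univ.filter fun t => (⟨l, t⟩ : (l : Fin ℓ) × Fin (nn l)) ∉ S with hA
    have h2 := finrank_span_finset_le_card (R := Fq) (A.image fun t => y ⟨l, t⟩)
    refine le_trans ?_ (h2.trans Finset.card_image_le)
    have := FiniteDimensional.span_finset Fq (A.image fun t => y ⟨l, t⟩)
    refine Submodule.finrank_mono (Submodule.span_le.2 ?_)
    rintro _ ⟨t, rfl⟩
    by_cases ht : (⟨l, t⟩ : (l : Fin ℓ) × Fin (nn l)) ∈ S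
    · simp [hS _ ht]
    · exact Submodule.subset_span (Finset.mem_coe.2 (Finset.mem_image_of_mem _ (by simp [hA, ht])))
  have h2 : ∑ l, (Finset.univ.filter fun t => (⟨l, t⟩ : (l : Fin ℓ) × Fin (nn l)) ∉ S).card =
      Sᶜ.card := by
    rw [← Finset.card_sigma]
    congr 1
    ext ⟨l, t⟩
    simp
  have h3 := Finset.card_add_card_compl S
  rw [Fintype.card_sigma] at h3
  simp only [Fintype.card_fin] at h3
  have h4 : sumRankWt Fq y ≤ Sᶜ.card := (Finset.sum_le_sum fun l _ => h1 l).trans h2.le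
  omega

theorem lrs_entry_smul {K L : Type*} [Field K] [Field L] [Algebra K L] {q : ℕ} (hq : 1 < q)
    {a : K} {c : L} (h : c ^ (q - 1) = algebraMap K L a) (b : K) (s : ℕ) :
    (a ^ ((q ^ s - 1) / (q - 1)) * b ^ q ^ s) • c = (b • c) ^ q ^ s := by
  have hdvd : q - 1 ∣ q ^ s - 1 := by simpa using Nat.sub_dvd_pow_sub_pow q 1 s
  have hpos : 0 < q ^ s := by positivity
  rw [smul_pow, mul_comm, mul_smul, Algebra.smul_def (_ ^ _) c, map_pow, ← h, ← pow_mul,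
    Nat.mul_div_cancel' hdvd, ← pow_succ, Nat.sub_add_cancel hpos]

/-- Main theorem: if the `Z_i ⊆ {1,…,n}` satisfy the GM–MDS condition
`|∩_{i∈Ω} Z_i| + |Ω| ≤ k`, then for every prime power `q ≥ ℓ + 1` and every `m`
with `m ≥ n_l` for all `l` and `q^m ≥ k·q^{k−1}`, there is an `[n,k]_{q^m}`
linearized Reed–Solomon code (with `ℓ` blocks of lengths `n_1, …, n_ℓ`) possessing
a generator matrix `G = T · G^LRS` fulfilling the support constraints; the code is
MSRD, i.e. its minimum sum-rank distance equals `n − k + 1`. -/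
theorem exists_LRS_with_support_constrained_generator
    (q m ℓ k : ℕ) (nn : Fin ℓ → ℕ) (hℓ : 1 ≤ ℓ) (hnn : ∀ l, 1 ≤ nn l)
    (hk : 1 ≤ k) (hkn : k ≤ ∑ l, nn l)
    (Fq K : Type*) [Field Fq] [Fintype Fq] (hq : Fintype.card Fq = q)
    [Field K] [Algebra Fq K] (hm : Module.finrank Fq K = m)
    (hqℓ : ℓ + 1 ≤ q) (hmn : ∀ l, nn l ≤ m) (hqm : k * q ^ (k - 1) ≤ q ^ m)
    (Z : Fin k → Finset ((l : Fin ℓ) × Fin (nn l)))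
    (hZ : ∀ Ω : Finset (Fin k), Ω.Nonempty → (Ω.inf Z).card + Ω.card ≤ k) :
    ∃ (a : Fin ℓ → K) (β : (l : Fin ℓ) → Fin (nn l) → K)
      (T : Matrix (Fin k) (Fin k) K) (G : Matrix (Fin k) ((l : Fin ℓ) × Fin (nn l)) K),
      -- block representatives: nonzero and pairwise non-σ-conjugate
      (∀ l, a l ≠ 0) ∧
      (∀ l l', l ≠ l' → ∀ c : K, c ≠ 0 → a l ≠ c ^ (q - 1) * a l') ∧
      -- column multipliers: F_q-linearly independent in each block
      (∀ l, LinearIndependent Fq (β l)) ∧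
      -- T is invertible and G = T · G^LRS
      IsUnit T.det ∧
      G = T * Matrix.of (fun (i : Fin k) (j : (l : Fin ℓ) × Fin (nn l)) =>
            a j.1 ^ ((q ^ (i : ℕ) - 1) / (q - 1)) * β j.1 j.2 ^ q ^ (i : ℕ)) ∧
      -- support constraints
      (∀ (i : Fin k) (j : (l : Fin ℓ) × Fin (nn l)), j ∈ Z i → G i j = 0) ∧
      -- G generates an [n,k] code ...
      G.rank = k ∧
      -- ... whose minimum sum-rank distance equals n − k + 1
      (∀ c ∈ Submodule.span K (Set.range fun i : Fin k => G i),
        c ≠ 0 → (∑ l, nn l) - k + 1 ≤ sumRankWt Fq c) ∧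
      (∃ c ∈ Submodule.span K (Set.range fun i : Fin k => G i),
        c ≠ 0 ∧ sumRankWt Fq c = (∑ l, nn l) - k + 1) := by
  classical
  subst hq hm
  obtain ⟨κ, rfl⟩ := Nat.exists_eq_add_of_le' hk
  have hq1 : 1 < Fintype.card Fq := Fintype.one_lt_card
  have hfd : Module.Finite Fq K :=
    Module.finite_of_finrank_pos (lt_of_lt_of_le (hnn ⟨0, hℓ⟩) (hmn ⟨0, hℓ⟩))
  have hfin : Finite K := Module.finite_of_finite Fq
  have hJ : Fintype.card ((l : Fin ℓ) × Fin (nn l)) = ∑ l, nn l := by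
    simp [Fintype.card_sigma]
  obtain ⟨Z', hZZ', hZ'card, hZ'⟩ := exists_enlarged_zero_pattern (by rwa [hJ]) Z hZ
  have hZ'card' : ∀ i, (Z' i).card = κ := fun i => Nat.succ_injective (hZ'card i)
  let z : Fin (κ + 1) → Fin κ → (l : Fin ℓ) × Fin (nn l) := fun i t =>
    ((Finset.equivFinOfCardEq (hZ'card' i)).symm t).1
  have hz : ∀ i, Function.Injective (z i) := fun i =>
    Subtype.val_injective.comp (Equiv.injective _)
  have hzmem : ∀ i, ∀ j ∈ Z' i, ∃ t, z i t = j := fun i j hj =>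
    ⟨Finset.equivFinOfCardEq (hZ'card' i) ⟨j, hj⟩, by simp [z]⟩
  have hzimage : (fun i => Finset.univ.image (z i)) = Z' := by
    ext i j
    rw [Finset.mem_image]
    refine ⟨?_, fun hj => ?_⟩
    · rintro ⟨t, -, rfl⟩
      exact ((Finset.equivFinOfCardEq (hZ'card' i)).symm t).2
    · obtain ⟨t, ht⟩ := hzmem i j hj
      exact ⟨t, Finset.mem_univ t, ht⟩
  obtain ⟨a, c, ha, hconj, hc, hcli⟩ :=
    exists_block_representatives (Fq := Fq) (K := K) (AlgebraicClosure K) hqℓ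
  obtain ⟨b, hb, hdet⟩ := exists_multipliers hmn hqm hz (by rwa [hzimage]) hcli
  set M : Matrix (Fin (κ + 1)) ((l : Fin ℓ) × Fin (nn l)) K := Matrix.of fun i j =>
    a j.1 ^ ((Fintype.card Fq ^ (i : ℕ) - 1) / (Fintype.card Fq - 1)) *
      b j ^ Fintype.card Fq ^ (i : ℕ) with hM
  have hentry : ∀ s j, M s j • c j.1 = (b j • c j.1) ^ Fintype.card Fq ^ (s : ℕ) :=
    fun s j => lrs_entry_smul hq1 (hc j.1) (b j) s
  set T : Matrix (Fin (κ + 1)) (Fin (κ + 1)) K :=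
    Matrix.of fun i => cofactorRow fun t r => M r (z i t) with hT
  have hTdet : T.det ≠ 0 := by
    intro h0
    have h1 : minorMatrix (fun r => Fintype.card Fq ^ r) z (fun j => b j • c j.1) =
        Matrix.of fun i s =>
          (∏ t, c (z i t).1) * T.map (algebraMap K (AlgebraicClosure K)) i s := by
      ext i s
      rw [Matrix.of_apply, Matrix.map_apply, hT, Matrix.of_apply, map_cofactorRow,
        ← cofactorRow_mul_left, minorMatrix, Matrix.of_apply]
      congr 1
      funext t r
      rw [← hentry, Algebra.smul_def, mul_comm]
    rw [h1, Matrix.det_mul_column, ← RingHom.mapMatrix_apply, ← RingHom.map_det, h0, map_zero,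
      mul_zero] at hdet
    exact hdet rfl
  have hGzero : ∀ i, ∀ j ∈ Z' i, (T * M) i j = 0 := by
    intro i j hj
    obtain ⟨t, rfl⟩ := hzmem i j hj
    exact sum_cofactorRow_mul_self (fun t r => M r (z i t)) t
  have hwt : ∀ w : Fin (κ + 1) → K, w ≠ 0 →
      ∑ l, nn l ≤ sumRankWt Fq (∑ i, w i • (T * M) i) + κ := by
    intro w hw
    have hf : Matrix.vecMul w T ≠ 0 := fun h => hw (Matrix.eq_zero_of_vecMul_eq_zero hTdet h)
    refine le_sumRankWt_add hcli hb hf fun j => ?_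
    have h1 : ∑ i, w i • (T * M) i = Matrix.vecMul (Matrix.vecMul w T) M := by
      rw [Matrix.vecMul_vecMul, Matrix.vecMul_eq_sum]
    rw [h1]
    generalize Matrix.vecMul w T = f
    simp_rw [← hentry, Matrix.vecMul, dotProduct, Finset.sum_smul, ← Algebra.smul_def, mul_smul]
  have hwt0 : ∀ w : Fin (κ + 1) → K, w ≠ 0 → ∑ i, w i • (T * M) i ≠ 0 := by
    intro w hw h0
    have h1 := hwt w hw
    have h2 := sumRankWt_add_card_le (Fq := Fq) (∑ i, w i • (T * M) i) Finset.univ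
      fun j _ => congrFun h0 j
    rw [Finset.card_univ, hJ] at h2
    omega
  refine ⟨a, fun l t => b ⟨l, t⟩, T, T * M, ha, hconj, hb, hTdet.isUnit, rfl,
    fun i j hj => hGzero i j (hZZ' i hj), ?_, ?_, ?_⟩
  · have hli : LinearIndependent K (T * M).row := by
      rw [Fintype.linearIndependent_iff]
      intro w hw
      by_contra! h
      exact hwt0 w (Function.ne_iff.2 h) hw
    rw [hli.rank_matrix, Fintype.card_fin]
  · intro y hy hy0
    obtain ⟨w, rfl⟩ := (Submodule.mem_span_range_iff_exists_fun K).1 hy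
    have hw : w ≠ 0 := by
      rintro rfl
      simp at hy0
    have := hwt w hw
    omega
  · have hsingle : ∑ i, (Pi.single 0 1 : Fin (κ + 1) → K) i • (T * M) i = (T * M) 0 := by
      rw [Finset.sum_eq_single 0 (fun i _ hi => by simp [hi]) (by simp), Pi.single_eq_same,
        one_smul]
    have hne : (Pi.single 0 1 : Fin (κ + 1) → K) ≠ 0 := by simp
    have h1 := hwt _ hne
    have h2 := hwt0 _ hne
    rw [hsingle] at h1 h2
    refine ⟨(T * M) 0, Submodule.subset_span ⟨0, rfl⟩, h2, ?_⟩
    have h3 := sumRankWt_add_card_le (Fq := Fq) ((T * M) 0) (Z' 0) (hGzero 0)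
    rw [hZ'card' 0] at h3
    omega
end

section
/- Let ℓ ≥ 1 and n_1, …, n_ℓ ≥ 1 be integers, n := n_1 + ⋯ + n_ℓ, and k ≥ 1. Let Z_1, …, Z_k ⊆ {1, …, n} be arbitrary, and set k̃ := max over nonempty Ω ⊆ {1, …, k} of (|∩_{i∈Ω} Z_i| + |Ω|); assume k̃ ≤ n. Then for every prime power q ≥ ℓ + 1 and every integer m with m ≥ n_l for all l and q^m ≥ k̃·q^{k̃−1} (equivalently m ≥ k̃ − 1 + log_q k̃), there exists a matrix G ∈ F_{q^m}^{k×n} of rank k with G_{ij} = 0 for all i ∈ {1, …, k} and j ∈ Z_i, such that every nonzero codeword in the row space of G has sum-rank weight at least n − k̃ + 1 with respect to the partition (n_1, …, n_ℓ); moreover this row space is a subcode of an [n, k̃]_{q^m} linearized Reed–Solomon code with ℓ blocks of lengths n_1, …, n_ℓ. -/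
/-- `k̃ = max_{∅ ≠ Ω ⊆ [k]} (|∩_{i∈Ω} Z_i| + |Ω|)`. -/
def ktilde {k : ℕ} {ι : Type*} [Fintype ι] [DecidableEq ι]
    (Z : Fin k → Finset ι) : ℕ :=
  ((Finset.univ : Finset (Fin k)).powerset.filter Finset.Nonempty).sup
    (fun Ω => (Ω.inf Z).card + Ω.card)

section

open Finset

theorem MvPolynomial.X_dvd_sub_aeval_zero {J K : Type*} [DecidableEq J] [Field K] (j : J)
    (f : MvPolynomial J K) :
    MvPolynomial.X j ∣ f - MvPolynomial.aeval
      (fun j' => if j' = j then (0 : MvPolynomial J K) else MvPolynomial.X j') f := by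
  induction f using MvPolynomial.induction_on with
  | C a => simp
  | add f g hf hg =>
    rw [map_add, add_sub_add_comm]
    exact dvd_add hf hg
  | mul_X f j' hf =>
    rw [map_mul, MvPolynomial.aeval_X]
    split_ifs with h
    · subst h
      simp
    · rw [← sub_mul]
      exact hf.mul_right _

theorem MvPolynomial.eq_zero_of_X_dvd_of_closed {T J K : Type*} [Field K] (j : J)
    (S : Set T) (P : (T → MvPolynomial J K) → Prop)
    (hdvd : ∀ f, P f → ∀ x ∈ S, MvPolynomial.X j ∣ f x)
    (hdiv : ∀ f g, P f → (∀ x ∈ S, f x = MvPolynomial.X j * g x) → P g)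
    (f : T → MvPolynomial J K) (hf : P f) : ∀ x ∈ S, f x = 0 := by
  classical
  have hpow : ∀ n : ℕ, ∀ f, P f → ∀ x ∈ S, (MvPolynomial.X j : MvPolynomial J K) ^ n ∣ f x := by
    intro n
    induction n with
    | zero => intro f _ x _; simp
    | succ n ih =>
      intro f hf x hx
      choose g hg using hdvd f hf
      have hg' : ∀ x (hx : x ∈ S), f x = MvPolynomial.X j *
          (fun x => if hx : x ∈ S then g x hx else 0) x := by
        intro x hx
        simp only [hx, dif_pos]
        exact hg x hx
      have := ih _ (hdiv f _ hf hg') x hx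
      rw [hg' x hx, pow_succ']
      exact mul_dvd_mul_left _ this
  intro x hx
  by_contra h0
  obtain ⟨n, hn⟩ := FiniteMultiplicity.of_not_isUnit
    (MvPolynomial.X_prime (R := K) (i := j)).not_isUnit h0
  exact hn (hpow (n + 1) f hf x hx)

/-- `f` is supported in degrees at least `τ` and orthogonal to the columns
`(c t j * X j ^ e t)_t`, `j ∈ Z`. -/
def GenericAdm {J K : Type*} [Field K] (k : ℕ) (c : ℕ → J → K) (e : ℕ → ℕ)
    (Z : Finset J) (τ : ℕ) (f : ℕ → MvPolynomial J K) : Prop :=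
  (∀ t < k, t < τ → f t = 0) ∧
    ∀ j ∈ Z, ∑ t ∈ range k, MvPolynomial.C (c t j) * MvPolynomial.X j ^ e t * f t = 0

/-- The inequality `∑_{i ∈ Ω} d i + |⋂_{i ∈ Ω} Z i| + min_{i ∈ Ω} τ i ≤ k` for all nonempty
`Ω ⊆ I`. -/
def HallCond {ι J : Type*} (k : ℕ) (I : Finset ι) (Z : ι → Finset J) (τ d : ι → ℕ) : Prop :=
  ∀ Ω ⊆ I, Ω.Nonempty → ∀ (W : Finset J) (t : ℕ), (∀ i ∈ Ω, W ⊆ Z i) → (∀ i ∈ Ω, t ≤ τ i) →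
    ∑ i ∈ Ω, d i + W.card + t ≤ k

theorem GenericAdm.mono {J K : Type*} [Field K] {k : ℕ} {c : ℕ → J → K} {e : ℕ → ℕ}
    {Z Z' : Finset J} {τ τ' : ℕ} {f : ℕ → MvPolynomial J K} (hf : GenericAdm k c e Z τ f)
    (hZ : Z' ⊆ Z) (hτ : τ' ≤ τ) : GenericAdm k c e Z' τ' f :=
  ⟨fun t ht h => hf.1 t ht (h.trans_le hτ), fun j hj => hf.2 j (hZ hj)⟩

theorem GenericAdm.of_mul_X {J K : Type*} [Field K] {k : ℕ} {c : ℕ → J → K}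
    {e : ℕ → ℕ} {Z : Finset J} {τ : ℕ} {f g : ℕ → MvPolynomial J K} (j : J)
    (hf : GenericAdm k c e Z τ f) (hg : ∀ t < k, f t = MvPolynomial.X j * g t) :
    GenericAdm k c e Z τ g := by
  have hX : (MvPolynomial.X j : MvPolynomial J K) ≠ 0 := MvPolynomial.X_ne_zero j
  refine ⟨fun t ht h => ?_, fun j' hj' => ?_⟩
  · have := hf.1 t ht h
    rw [hg t ht] at this
    exact (mul_eq_zero.mp this).resolve_left hX
  · have := hf.2 j' hj'
    refine (mul_eq_zero.mp (?_ : MvPolynomial.X j * _ = 0)).resolve_left hX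
    rw [← this, mul_sum]
    refine sum_congr rfl fun t ht => ?_
    rw [hg t (mem_range.mp ht)]
    ring

theorem GenericAdm.specialize {J K : Type*} [DecidableEq J] [Field K] {k : ℕ} {c : ℕ → J → K}
    (hc : ∀ t j, c t j ≠ 0) {e : ℕ → ℕ} (he : StrictMono e)
    {Z : Finset J} {τ : ℕ} {f : ℕ → MvPolynomial J K} (hf : GenericAdm k c e Z τ f) (j : J) :
    GenericAdm k c e (Z.erase j) (τ + if j ∈ Z then 1 else 0)
      (fun t => MvPolynomial.aeval
        (fun j' => if j' = j then (0 : MvPolynomial J K) else MvPolynomial.X j') (f t)) := by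
  set s := MvPolynomial.aeval (R := K)
        (fun j' => if j' = j then (0 : MvPolynomial J K) else MvPolynomial.X j') with hs
  refine ⟨fun t ht h => ?_, fun j' hj' => ?_⟩
  · rcases lt_or_ge t τ with h' | h'
    · simp [hf.1 t ht h']
    have hjZ : j ∈ Z := by
      by_contra hn
      simp [hn] at h
      omega
    have htτ : t = τ := by
      simp only [hjZ, if_true] at h
      omega
    subst htτ
    have h1 := hf.2 j hjZ
    have h2 : ∑ u ∈ range k, MvPolynomial.C (c u j) * MvPolynomial.X j ^ e u * f u =
        MvPolynomial.X j ^ e t * ∑ u ∈ range k,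
          (MvPolynomial.C (c u j) * MvPolynomial.X j ^ (e u - e t) * f u) := by
      rw [mul_sum]
      refine sum_congr rfl fun u hu => ?_
      rcases lt_or_ge u t with hut | hut
      · simp [hf.1 u (mem_range.mp hu) hut]
      · have : e u = e t + (e u - e t) := by have := he.monotone hut; omega
        conv_lhs => rw [this, pow_add]
        ring
    rw [h2] at h1
    have h3 := (mul_eq_zero.mp h1).resolve_left (pow_ne_zero _ (MvPolynomial.X_ne_zero j))
    have h4 := congrArg s h3
    rw [map_sum, map_zero, sum_eq_single t] at h4
    · rw [map_mul, map_mul, map_pow, Nat.sub_self, pow_zero, mul_one, ← MvPolynomial.algebraMap_eq,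
        AlgHom.commutes, MvPolynomial.algebraMap_eq] at h4
      refine (mul_eq_zero.mp h4).resolve_left ?_
      simpa using hc t j
    · intro u hu hut
      rcases lt_or_ge u t with h' | h'
      · simp [hf.1 u (mem_range.mp hu) h']
      · have : e u - e t ≠ 0 := by have := he (lt_of_le_of_ne h' (Ne.symm hut)); omega
        simp [hs, this]
    · intro h'; exact absurd (mem_range.mpr ht) h'
  · have hne := (mem_erase.mp hj').1
    have h1 := congrArg s (hf.2 j' (mem_erase.mp hj').2)
    rw [map_sum, map_zero] at h1
    rw [← h1]
    refine sum_congr rfl fun t _ => ?_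
    rw [map_mul, map_mul, map_pow, hs, MvPolynomial.aeval_X, if_neg hne,
      ← MvPolynomial.algebraMap_eq, AlgHom.commutes]

theorem GenericAdm.eq_zero {J K : Type*} [Field K] {k : ℕ} {c : ℕ → J → K}
    (hc : ∀ t j, c t j ≠ 0) {e : ℕ → ℕ} (he : StrictMono e)
    {Z : Finset J} {τ : ℕ} (hk : k ≤ Z.card + τ) {f : ℕ → MvPolynomial J K}
    (hf : GenericAdm k c e Z τ f) : ∀ t < k, f t = 0 := by
  classical
  induction hn : Z.card generalizing Z τ f with
  | zero => exact fun t ht => hf.1 t ht (by omega)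
  | succ n ih =>
    obtain ⟨j, hj⟩ : Z.Nonempty := by rw [← card_pos]; omega
    refine MvPolynomial.eq_zero_of_X_dvd_of_closed j {t | t < k} (GenericAdm k c e Z τ)
      (fun f hf t ht => ?_) (fun f g hf hg => hf.of_mul_X j hg) f hf
    have hcard := card_erase_of_mem hj
    have := ih (by simp only [hj, if_true]; omega) (hf.specialize hc he j) (by omega) t ht
    have hd := MvPolynomial.X_dvd_sub_aeval_zero j (f t)
    rwa [this, sub_zero] at hd

theorem genericAdm_independent {ι J K : Type*} [Field K] {k : ℕ} {c : ℕ → J → K}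
    (hc : ∀ t j, c t j ≠ 0) {e : ℕ → ℕ} (he : StrictMono e)
    (I : Finset ι) (Z : ι → Finset J) (τ d : ι → ℕ)
    (hd : ∀ i ∈ I, (Z i).card + τ i + d i = k) (hpos : ∀ i ∈ I, 0 < d i)
    (hH : HallCond k I Z τ d) (f : ι → ℕ → MvPolynomial J K)
    (hf : ∀ i ∈ I, GenericAdm k c e (Z i) (τ i) (f i))
    (hsum : ∀ t < k, ∑ i ∈ I, f i t = 0) : ∀ i ∈ I, ∀ t < k, f i t = 0 := by
  classical
  induction hs : I.card using Nat.strong_induction_on generalizing I Z τ d f with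
  | _ s ihs =>
  induction hμ : ∑ i ∈ I, (k - τ i) using Nat.strong_induction_on generalizing I Z τ d f with
  | _ μ ihμ =>
  by_cases htight : ∃ Ω ⊆ I, 2 ≤ Ω.card ∧ Ω.card < I.card ∧ ∃ (W : Finset J) (t : ℕ),
      (∀ i ∈ Ω, W ⊆ Z i) ∧ (∀ i ∈ Ω, t ≤ τ i) ∧ ∑ i ∈ Ω, d i + W.card + t = k
  · obtain ⟨Ω, hΩ, h2, hlt, W, t₀, hW, ht₀, heq⟩ := htight
    obtain ⟨i₀, hi₀⟩ : Ω.Nonempty := by rw [← card_pos]; omega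
    have hI : i₀ ∉ I \ Ω := by simp [hi₀]
    have hne : ∀ i ∈ I \ Ω, i ≠ i₀ := fun i hi h => hI (h ▸ hi)
    have hcI : (insert i₀ (I \ Ω)).card < s := by
      rw [card_insert_of_notMem hI, card_sdiff_of_subset hΩ]
      omega
    have key := ihs _ hcI (insert i₀ (I \ Ω))
      (Function.update Z i₀ W) (Function.update τ i₀ t₀)
      (Function.update d i₀ (∑ i ∈ Ω, d i)) ?_ ?_ ?_
      (Function.update f i₀ (fun t => ∑ i ∈ Ω, f i t)) ?_ ?_ rfl
    · intro i hi t ht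
      by_cases hiΩ : i ∈ Ω
      · refine ihs _ (by omega) Ω Z τ d (fun i hi => hd i (hΩ hi)) (fun i hi => hpos i (hΩ hi))
          (fun Ω' hΩ' => hH Ω' (hΩ'.trans hΩ)) f (fun i hi => hf i (hΩ hi)) ?_ rfl i hiΩ t ht
        intro t ht
        have := key i₀ (mem_insert_self _ _) t ht
        simpa using this
      · have hi' : i ∈ I \ Ω := mem_sdiff.mpr ⟨hi, hiΩ⟩
        have := key i (mem_insert_of_mem hi') t ht
        rwa [Function.update_of_ne (hne i hi')] at this
    · intro i hi
      rcases mem_insert.mp hi with rfl | hi'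
      · simp only [Function.update_self]
        omega
      · simp only [Function.update_of_ne (hne i hi')]
        exact hd i (mem_sdiff.mp hi').1
    · intro i hi
      rcases mem_insert.mp hi with rfl | hi'
      · simp only [Function.update_self]
        exact sum_pos (fun i hi => hpos i (hΩ hi)) ⟨_, hi₀⟩
      · simp only [Function.update_of_ne (hne i hi')]
        exact hpos i (mem_sdiff.mp hi').1
    · intro Ω' hΩ' hΩ'n W' t' hW' ht'
      by_cases hi₀' : i₀ ∈ Ω'
      · have hsub : Ω'.erase i₀ ⊆ I \ Ω := by
          intro i hi
          have := hΩ' (mem_of_mem_erase hi)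
          exact (mem_insert.mp this).resolve_left (ne_of_mem_erase hi)
        have hdisj : Disjoint Ω (Ω'.erase i₀) :=
          disjoint_sdiff.mono_right hsub
        have := hH (Ω ∪ Ω'.erase i₀)
          (union_subset hΩ (hsub.trans sdiff_subset)) ⟨i₀, mem_union_left _ hi₀⟩ W' t' ?_ ?_
        · rw [sum_union hdisj] at this
          rw [← add_sum_erase _ _ hi₀', Function.update_self]
          rwa [sum_congr rfl fun i hi => Function.update_of_ne (ne_of_mem_erase hi) _ d]
        · intro i hi
          rcases mem_union.mp hi with h | h
          · have := hW' i₀ hi₀'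
            rw [Function.update_self] at this
            exact this.trans (hW i h)
          · have := hW' i (mem_of_mem_erase h)
            rwa [Function.update_of_ne (ne_of_mem_erase h)] at this
        · intro i hi
          rcases mem_union.mp hi with h | h
          · have := ht' i₀ hi₀'
            rw [Function.update_self] at this
            exact this.trans (ht₀ i h)
          · have := ht' i (mem_of_mem_erase h)
            rwa [Function.update_of_ne (ne_of_mem_erase h)] at this
      · have hsub : Ω' ⊆ I \ Ω := fun i hi =>
          (mem_insert.mp (hΩ' hi)).resolve_left fun h => hi₀' (h ▸ hi)
        have hu : ∀ i ∈ Ω', i ≠ i₀ := fun i hi => hne i (hsub hi)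
        rw [sum_congr rfl fun i hi => Function.update_of_ne (hu i hi) _ d]
        refine hH Ω' (hsub.trans sdiff_subset) hΩ'n W' t' (fun i hi => ?_) (fun i hi => ?_)
        · simpa [Function.update_of_ne (hu i hi)] using hW' i hi
        · simpa [Function.update_of_ne (hu i hi)] using ht' i hi
    · intro i hi
      rcases mem_insert.mp hi with rfl | hi'
      · simp only [Function.update_self]
        refine ⟨fun t ht h => sum_eq_zero fun i hi => ?_, fun j hj => ?_⟩
        · exact (hf i (hΩ hi)).1 t ht (h.trans_le (ht₀ i hi))
        · simp_rw [mul_sum]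
          rw [sum_comm]
          exact sum_eq_zero fun i hi => (hf i (hΩ hi)).2 j (hW i hi hj)
      · simp only [Function.update_of_ne (hne i hi')]
        exact hf i (mem_sdiff.mp hi').1
    · intro t ht
      have hrest : ∑ i ∈ I \ Ω, Function.update f i₀ (fun t => ∑ i ∈ Ω, f i t) i t =
          ∑ i ∈ I \ Ω, f i t :=
        sum_congr rfl fun i hi => by rw [Function.update_of_ne (hne i hi)]
      rw [sum_insert hI, Function.update_self, hrest, add_comm, sum_sdiff hΩ]
      exact hsum t ht
  push Not at htight
  rcases I.eq_empty_or_nonempty with rfl | hIne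
  · simp
  obtain ⟨i₀, hi₀, hmin⟩ := exists_min_image I τ hIne
  have hlt : ∀ i ∈ I, τ i < k := fun i hi => by have := hd i hi; have := hpos i hi; omega
  by_cases huniq : ∃ i₁ ∈ I, i₁ ≠ i₀ ∧ τ i₁ = τ i₀
  · obtain ⟨i₁, hi₁, hne, hτ⟩ := huniq
    obtain ⟨j, hj₁, hj₀⟩ : ∃ j ∈ Z i₁, j ∉ Z i₀ := by
      by_contra! hcon
      have := hH {i₀, i₁} (by simp [insert_subset_iff, hi₀, hi₁]) ⟨i₀, by simp⟩ (Z i₁) (τ i₀)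
        (by simpa [subset_iff] using hcon) (by simp [hτ])
      rw [sum_pair hne.symm] at this
      have := hd i₁ hi₁
      have := hpos i₀ hi₀
      omega
    have hcase : ∀ f : ι × ℕ → MvPolynomial J K,
        ((∀ i ∈ I, GenericAdm k c e (Z i) (τ i) (fun t => f (i, t))) ∧
          ∀ t < k, ∑ i ∈ I, f (i, t) = 0) → ∀ x ∈ {x : ι × ℕ | x.1 ∈ I ∧ x.2 < k}, f x = 0 := by
      refine MvPolynomial.eq_zero_of_X_dvd_of_closed j _ _ ?_ ?_
      · rintro f ⟨hf, hsum⟩ ⟨i, t⟩ ⟨hi, ht⟩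
        have hz := ihμ (∑ i ∈ I, (k - (τ i + if j ∈ Z i then 1 else 0))) ?_ I
          (fun i => (Z i).erase j) (fun i => τ i + if j ∈ Z i then 1 else 0) d ?_ hpos ?_
          _ (fun i hi => (hf i hi).specialize hc he j) ?_ hs rfl i hi t ht
        · have := MvPolynomial.X_dvd_sub_aeval_zero j (f (i, t))
          rwa [hz, sub_zero] at this
        · rw [← hμ]
          refine sum_lt_sum (fun i _ => by omega) ⟨i₁, hi₁, ?_⟩
          have := hlt i₁ hi₁
          simp only [hj₁, if_true]
          omega
        · intro i hi
          have h1 := hd i hi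
          split_ifs with h
          · have := card_erase_of_mem h
            have := card_pos.mpr ⟨j, h⟩
            omega
          · rw [erase_eq_of_notMem h]
            omega
        · intro Ω hΩ hΩn W t' hW ht'
          have hWZ : ∀ i ∈ Ω, W ⊆ Z i := fun i hi => (hW i hi).trans (erase_subset _ _)
          have hjW : j ∉ W := by
            obtain ⟨i, hi⟩ := hΩn
            exact fun h => absurd (hW i hi h) (by simp)
          by_cases hle : ∀ i ∈ Ω, t' ≤ τ i
          · exact hH Ω hΩ hΩn W t' hWZ hle
          have hle' : ∀ i ∈ Ω, t' - 1 ≤ τ i := fun i hi => by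
            have := ht' i hi
            dsimp only at this
            split_ifs at this <;> omega
          have ht'pos : 1 ≤ t' := by
            by_contra h
            exact hle fun i _ => by omega
          by_cases hall : ∀ i ∈ Ω, j ∈ Z i
          · have := hH Ω hΩ hΩn (insert j W) (t' - 1)
              (fun i hi => insert_subset (hall i hi) (hWZ i hi)) hle'
            rw [card_insert_of_notMem hjW] at this
            omega
          · have h1 := hH Ω hΩ hΩn W (t' - 1) hWZ hle'
            push Not at hall hle
            obtain ⟨i₂, hi₂, hji₂⟩ := hall
            obtain ⟨i₃, hi₃, hti₃⟩ := hle
            have h2 : t' ≤ τ i₂ := by simpa [hji₂] using ht' i₂ hi₂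
            have h3 : i₂ ≠ i₃ := by rintro rfl; omega
            have hc2 : 2 ≤ Ω.card := one_lt_card.mpr ⟨i₂, hi₂, i₃, hi₃, h3⟩
            have hcI : Ω.card < I.card := by
              refine card_lt_card (hΩ.ssubset_of_ne ?_)
              rintro rfl
              have := ht' i₀ hi₀
              simp only [hj₀, if_false] at this
              have := hmin i₃ hi₃
              omega
            have := htight Ω hΩ hc2 hcI W (t' - 1) hWZ hle'
            omega
        · intro t ht
          rw [← map_sum, hsum t ht, map_zero]
      · rintro f g ⟨hf, hsum⟩ hg
        refine ⟨fun i hi => (hf i hi).of_mul_X j fun t ht => hg (i, t) ⟨hi, ht⟩, fun t ht => ?_⟩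
        have := hsum t ht
        rw [sum_congr rfl fun i hi => hg (i, t) ⟨hi, ht⟩, ← mul_sum] at this
        exact (mul_eq_zero.mp this).resolve_left (MvPolynomial.X_ne_zero j)
    exact fun i hi t ht => hcase (fun x => f x.1 x.2) ⟨hf, hsum⟩ (i, t) ⟨hi, ht⟩
  · push Not at huniq
    have hgt : ∀ i ∈ I, i ≠ i₀ → τ i₀ < τ i := fun i hi hne =>
      lt_of_le_of_ne (hmin i hi) (huniq i hi hne).symm
    have hz : f i₀ (τ i₀) = 0 := by
      have := hsum _ (hlt i₀ hi₀)
      rwa [sum_eq_single_of_mem i₀ hi₀ fun i hi hne =>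
        (hf i hi).1 _ (hlt i₀ hi₀) (hgt i hi hne)] at this
    have hadm : GenericAdm k c e (Z i₀) (τ i₀ + 1) (f i₀) := by
      refine ⟨fun t ht h => ?_, (hf i₀ hi₀).2⟩
      rcases Nat.lt_succ_iff_lt_or_eq.mp h with h | rfl
      · exact (hf i₀ hi₀).1 t ht h
      · exact hz
    by_cases hd1 : d i₀ = 1
    · have hz₀ : ∀ t < k, f i₀ t = 0 :=
        hadm.eq_zero hc he (by have := hd i₀ hi₀; omega)
      have hrest := ihs _ (by rw [← hs]; exact card_erase_lt_of_mem hi₀) (I.erase i₀) Z τ d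
        (fun i hi => hd i (mem_of_mem_erase hi)) (fun i hi => hpos i (mem_of_mem_erase hi))
        (fun Ω hΩ => hH Ω (hΩ.trans (erase_subset _ _))) f
        (fun i hi => hf i (mem_of_mem_erase hi))
        (fun t ht => by
          have := hsum t ht
          rwa [← add_sum_erase _ _ hi₀, hz₀ t ht, zero_add] at this) rfl
      intro i hi t ht
      by_cases h : i = i₀
      · exact h ▸ hz₀ t ht
      · exact hrest i (mem_erase.mpr ⟨h, hi⟩) t ht
    · refine ihμ _ ?_ I Z (Function.update τ i₀ (τ i₀ + 1)) (Function.update d i₀ (d i₀ - 1))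
        ?_ ?_ ?_ f ?_ hsum hs rfl
      · rw [← hμ]
        refine sum_lt_sum (fun i _ => ?_) ⟨i₀, hi₀, ?_⟩
        · rcases eq_or_ne i i₀ with rfl | h
          · simp; omega
          · simp [h]
        · have := hlt i₀ hi₀
          simp only [Function.update_self]
          omega
      · intro i hi
        have := hd i hi
        have := hpos i hi
        rcases eq_or_ne i i₀ with rfl | h
        · simp only [Function.update_self]; omega
        · simpa [h]
      · intro i hi
        have := hpos i hi
        rcases eq_or_ne i i₀ with rfl | h
        · simp only [Function.update_self]; omega
        · simpa [h]
      · intro Ω hΩ hΩn W t' hW ht'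
        by_cases hi₀Ω : i₀ ∈ Ω
        · have h1 := hH Ω hΩ hΩn W (t' - 1) hW fun i hi => by
            have := ht' i hi
            rcases eq_or_ne i i₀ with rfl | h
            · simp only [Function.update_self] at this; omega
            · simp only [Function.update_of_ne h] at this; omega
          have hrest : ∑ i ∈ Ω.erase i₀, Function.update d i₀ (d i₀ - 1) i =
              ∑ i ∈ Ω.erase i₀, d i :=
            sum_congr rfl fun i hi => Function.update_of_ne (ne_of_mem_erase hi) _ d
          rw [← add_sum_erase _ _ hi₀Ω] at h1 ⊢
          rw [hrest, Function.update_self]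
          have := hpos i₀ hi₀
          omega
        · have hu : ∀ i ∈ Ω, i ≠ i₀ := fun i hi h => hi₀Ω (h ▸ hi)
          rw [sum_congr rfl fun i hi => Function.update_of_ne (hu i hi) _ d]
          refine hH Ω hΩ hΩn W t' hW fun i hi => ?_
          simpa [Function.update_of_ne (hu i hi)] using ht' i hi
      · intro i hi
        rcases eq_or_ne i i₀ with rfl | h
        · simpa using hadm
        · simpa [h] using hf i hi

theorem FiniteField.exists_algebraMap_eq_of_pow_card_eq {F L : Type*} [Field F] [Fintype F]
    [Field L] [Algebra F L] {x : L} (hx : x ^ Fintype.card F = x) :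
    ∃ u : F, algebraMap F L u = x := by
  have h1 : (Polynomial.X ^ Fintype.card F - Polynomial.X : Polynomial F) =
      (univ.val.map fun a : F => Polynomial.X - Polynomial.C a).prod := by
    have h := Polynomial.C_leadingCoeff_mul_prod_multiset_X_sub_C
      (p := (Polynomial.X ^ Fintype.card F - Polynomial.X : Polynomial F))
      (by rw [FiniteField.roots_X_pow_card_sub_X,
            FiniteField.X_pow_card_sub_X_natDegree_eq F Fintype.one_lt_card]; rfl)
    rw [FiniteField.roots_X_pow_card_sub_X] at h
    have hm : (Polynomial.X ^ Fintype.card F - Polynomial.X : Polynomial F).Monic :=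
      Polynomial.monic_X_pow_sub (by
        rw [Polynomial.degree_X]; exact_mod_cast Fintype.one_lt_card)
    rwa [hm.leadingCoeff, map_one, one_mul, eq_comm] at h
  have h2 := congrArg (Polynomial.aeval x) h1
  rw [map_sub, map_pow, Polynomial.aeval_X, hx, sub_self, Polynomial.aeval_def,
    Polynomial.eval₂_multiset_prod, Multiset.map_map, eq_comm, Multiset.prod_eq_zero_iff] at h2
  obtain ⟨u, -, hu⟩ := Multiset.mem_map.mp h2
  refine ⟨u, ?_⟩
  simp only [Function.comp_apply, Polynomial.eval₂_sub, Polynomial.eval₂_X,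
    Polynomial.eval₂_C] at hu
  exact (sub_eq_zero.mp hu).symm

/-- The entry `N_t(a) p ^ (q ^ t)` in row `t` of the column of a generalized Moore matrix
attached to the point `p` of the block with parameter `a`. -/
def mooreEntry {L : Type*} [Semiring L] (q : ℕ) (a p : L) (t : ℕ) : L :=
  a ^ ((q ^ t - 1) / (q - 1)) * p ^ q ^ t

/-- In every block, the points indexed by `Z` are linearly independent. -/
def BlockIndep (F : Type*) {ι κ L : Type*} [DecidableEq κ] [Field F] [Field L] [Algebra F L]
    (b : ι → κ) (p : ι → L) (Z : Finset ι) : Prop :=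
  ∀ (l : κ) (w : ι → F), ∑ j ∈ Z with b j = l, w j • p j = 0 → ∀ j ∈ Z, b j = l → w j = 0

/-- Nonzero, pairwise non-conjugate parameters. -/
def NonConj {κ L : Type*} [Field L] (q : ℕ) (a : κ → L) : Prop :=
  (∀ l, a l ≠ 0) ∧ ∀ l l', l ≠ l' → ∀ c : L, c ≠ 0 → a l ≠ c ^ (q - 1) * a l'

theorem pow_geom_succ {q : ℕ} (hq : 2 ≤ q) (t : ℕ) :
    (q ^ (t + 1) - 1) / (q - 1) = (q ^ t - 1) / (q - 1) + q ^ t := by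
  rw [← Nat.geomSum_eq hq, ← Nat.geomSum_eq hq, sum_range_succ]

theorem pow_geom_succ' {q : ℕ} (hq : 2 ≤ q) (t : ℕ) :
    (q ^ (t + 1) - 1) / (q - 1) = (q ^ t - 1) / (q - 1) * q + 1 := by
  rw [← Nat.geomSum_eq hq, ← Nat.geomSum_eq hq, sum_range_succ', sum_mul]
  simp [pow_succ]

section Moore

variable {L : Type*} [CommSemiring L] {q : ℕ}

@[simp]
theorem mooreEntry_zero (a p : L) : mooreEntry q a p 0 = p := by simp [mooreEntry]

theorem mooreEntry_succ (hq : 2 ≤ q) (a p : L) (t : ℕ) :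
    mooreEntry q a p (t + 1) = mooreEntry q a p t * (a * p ^ (q - 1)) ^ q ^ t := by
  have : q ^ (t + 1) = q ^ t + (q - 1) * q ^ t := by
    obtain ⟨r, rfl⟩ := Nat.exists_eq_add_of_le hq
    have : 2 + r - 1 = r + 1 := by omega
    rw [this, pow_succ]; ring
  rw [mooreEntry, mooreEntry, pow_geom_succ hq, this]
  ring

theorem mooreEntry_succ' (hq : 2 ≤ q) (a p : L) (t : ℕ) :
    mooreEntry q a p (t + 1) = a * mooreEntry q a p t ^ q := by
  rw [mooreEntry, mooreEntry, pow_geom_succ' hq]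
  ring

theorem mooreEntry_mul (a p c : L) (t : ℕ) :
    mooreEntry q a (p * c) t = mooreEntry q a p t * c ^ q ^ t := by
  rw [mooreEntry, mooreEntry]
  ring

end Moore

theorem sub_pow_card_pow {F L : Type*} [Field F] [Fintype F] [Field L] [Algebra F L]
    (x y : L) (t : ℕ) :
    (x - y) ^ Fintype.card F ^ t = x ^ Fintype.card F ^ t - y ^ Fintype.card F ^ t := by
  induction t with
  | zero => simp
  | succ t ih =>
    rw [pow_succ, pow_mul, pow_mul, pow_mul, ih]
    exact map_sub (FiniteField.frobeniusAlgHom F L) _ _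

section Independence

variable {F ι κ L : Type*} [DecidableEq κ] [Field F] [Field L] [Algebra F L]
  {b : ι → κ} {p : ι → L} {Z : Finset ι}

theorem BlockIndep.mono (hp : BlockIndep F b p Z) {Z' : Finset ι} (h : Z' ⊆ Z) :
    BlockIndep F b p Z' := by
  classical
  intro l w hw j hj hb
  have := hp l (fun i => if i ∈ Z' then w i else 0) ?_ j (h hj) hb
  · simpa [hj] using this
  · rw [← hw]
    refine (sum_subset_zero_on_sdiff (filter_subset_filter _ h) ?_ ?_).symm
    · intro i hi
      simp only [mem_sdiff, mem_filter, not_and] at hi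
      rw [if_neg fun h => hi.2 h hi.1.2, zero_smul]
    · intro i hi
      simp [(mem_filter.mp hi).1]

theorem BlockIndep.ne_zero (hp : BlockIndep F b p Z) {j : ι} (hj : j ∈ Z) : p j ≠ 0 := by
  classical
  intro h0
  have := hp (b j) (fun i => if i = j then 1 else 0) (sum_eq_zero fun i _ => ?_) j hj rfl
  · simp at this
  · by_cases h : i = j
    · simp [h, h0]
    · simp [h]

theorem BlockIndep.twist [Fintype F] {q : ℕ} (hq : Fintype.card F = q) {a : κ → L}
    (ha : NonConj q a) [DecidableEq ι] (hp : BlockIndep F b p Z) {j₀ : ι} (hj₀ : j₀ ∈ Z) :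
    BlockIndep F b (fun j => p j * (a (b j) * p j ^ (q - 1) - a (b j₀) * p j₀ ^ (q - 1)))
      (Z.erase j₀) := by
  intro l w hw j hj hb
  have hq2 : 2 ≤ q := hq ▸ Fintype.one_lt_card
  have hp0 := hp.ne_zero hj₀
  have hqs : ∀ x : L, x * x ^ (q - 1) = x ^ q := fun x => by
    rw [← pow_succ']; congr 1; omega
  set s := ∑ i ∈ Z.erase j₀ with b i = l, w i • p i with hs
  have hsq : ∑ i ∈ Z.erase j₀ with b i = l, w i • p i ^ q = s ^ q := by
    rw [hs, ← hq]
    have := map_sum (FiniteField.frobeniusAlgHom F L)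
      (fun i => w i • p i) ((Z.erase j₀).filter fun i => b i = l)
    simp only [map_smul, FiniteField.coe_frobeniusAlgHom] at this
    exact this.symm
  have key : s * (a l * s ^ (q - 1) - a (b j₀) * p j₀ ^ (q - 1)) = 0 := by
    rw [← hw, mul_sub, mul_left_comm, hqs, ← hsq, hs, mul_sum, sum_mul, ← sum_sub_distrib]
    refine sum_congr rfl fun i hi => ?_
    dsimp only
    rw [(mem_filter.mp hi).2, mul_sub (p i), mul_left_comm (p i), hqs]
    simp only [Algebra.smul_def]
    ring
  have hsub : ∀ u : F, (b j₀ = l ∨ u = 0) → s = u • p j₀ → w j = 0 := by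
    intro u hu hsu
    have hjne := ne_of_mem_erase hj
    have := hp l (fun i => if i = j₀ then -u else w i) ?_ j (mem_of_mem_erase hj) hb
    · simpa [hjne] using this
    have hcongr : ∑ i ∈ Z.erase j₀ with b i = l, (if i = j₀ then -u else w i) • p i = s :=
      sum_congr rfl fun i hi => by rw [if_neg (ne_of_mem_erase (mem_filter.mp hi).1)]
    by_cases hbl : b j₀ = l
    · rw [← add_sum_erase _ _ (mem_filter.mpr ⟨hj₀, hbl⟩), ← filter_erase, hcongr, hsu]
      simp
    · have hu0 := hu.resolve_left hbl
      have : (Z.filter fun i => b i = l) = (Z.erase j₀).filter fun i => b i = l := by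
        ext i
        simp only [mem_filter, mem_erase]
        refine ⟨fun h => ⟨⟨?_, h.1⟩, h.2⟩, fun h => ⟨h.1.2, h.2⟩⟩
        rintro rfl
        exact hbl h.2
      rw [this, hcongr, hsu, hu0, zero_smul]
  by_cases hs0 : s = 0
  · exact hsub 0 (Or.inr rfl) (by simp [hs0])
  have h1 : a l * s ^ (q - 1) = a (b j₀) * p j₀ ^ (q - 1) :=
    sub_eq_zero.mp ((mul_eq_zero.mp key).resolve_left hs0)
  have hbl : b j₀ = l := by
    by_contra hne
    refine ha.2 l (b j₀) (Ne.symm hne) (p j₀ / s) (div_ne_zero hp0 hs0) ?_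
    rw [div_pow, div_mul_eq_mul_div, eq_div_iff (pow_ne_zero _ hs0), h1, mul_comm]
  rw [hbl] at h1
  have h2 := mul_left_cancel₀ (ha.1 l) h1
  have h3 : (s / p j₀) ^ Fintype.card F = s / p j₀ := by
    rw [hq, ← hqs, div_pow, h2, div_self (pow_ne_zero _ hp0), mul_one]
  obtain ⟨u, hu⟩ := FiniteField.exists_algebraMap_eq_of_pow_card_eq h3
  refine hsub u (Or.inl hbl) ?_
  rw [Algebra.smul_def, hu, div_mul_cancel₀ _ hp0]

theorem BlockIndep.moore_columns [Fintype F] {q : ℕ} (hq : Fintype.card F = q) {a : κ → L}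
    (ha : NonConj q a) (hp : BlockIndep F b p Z) (v : ι → L)
    (hv : ∀ t < Z.card, ∑ j ∈ Z, v j * mooreEntry q (a (b j)) (p j) t = 0) :
    ∀ j ∈ Z, v j = 0 := by
  classical
  have hq2 : 2 ≤ q := hq ▸ Fintype.one_lt_card
  induction hn : Z.card generalizing Z p with
  | zero => simp_all
  | succ n ih =>
    obtain ⟨j₀, hj₀⟩ : Z.Nonempty := by rw [← card_pos]; omega
    have hcard : (Z.erase j₀).card = n := by rw [card_erase_of_mem hj₀]; omega
    have hrest := ih (hp.twist hq ha hj₀) (fun t ht => ?_) hcard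
    · intro j hj
      by_cases hjj : j = j₀
      · subst hjj
        have := hv 0 (by omega)
        rw [sum_eq_single_of_mem j hj fun i hi hij => by
          rw [hrest i (mem_erase.mpr ⟨hij, hi⟩), zero_mul]] at this
        rw [mooreEntry_zero] at this
        exact (mul_eq_zero.mp this).resolve_right (hp.ne_zero hj)
      · exact hrest j (mem_erase.mpr ⟨hjj, hj⟩)
    · have h1 := hv (t + 1) (by omega)
      have h2 := hv t (by omega)
      have h3 : ∑ j ∈ Z, v j * mooreEntry q (a (b j))
          (p j * (a (b j) * p j ^ (q - 1) - a (b j₀) * p j₀ ^ (q - 1))) t = 0 := by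
        calc _ = ∑ j ∈ Z, v j * mooreEntry q (a (b j)) (p j) (t + 1) -
              (a (b j₀) * p j₀ ^ (q - 1)) ^ q ^ t *
                ∑ j ∈ Z, v j * mooreEntry q (a (b j)) (p j) t := by
              rw [mul_sum, ← sum_sub_distrib]
              refine sum_congr rfl fun j _ => ?_
              rw [mooreEntry_mul, mooreEntry_succ hq2, ← hq, sub_pow_card_pow]
              ring
          _ = 0 := by rw [h1, h2]; simp
      have hz : mooreEntry q (a (b j₀)) 0 t = 0 := by
        rw [mooreEntry, zero_pow (pow_ne_zero _ (by omega)), mul_zero]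
      rw [← add_sum_erase _ _ hj₀, sub_self, mul_zero, hz, mul_zero, zero_add] at h3
      exact h3

theorem BlockIndep.moore_rows [Fintype F] {q : ℕ} (hq : Fintype.card F = q) {a : κ → L}
    (ha : NonConj q a) (hp : BlockIndep F b p Z) (f : ℕ → L)
    (hf : ∀ j ∈ Z, ∑ t ∈ range Z.card, f t * mooreEntry q (a (b j)) (p j) t = 0) :
    ∀ t < Z.card, f t = 0 := by
  classical
  set e := Z.equivFin
  let M : Matrix (Fin Z.card) (Fin Z.card) L := fun t s =>
    mooreEntry q (a (b (e.symm s))) (p (e.symm s)) t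
  have hdet : M.det ≠ 0 := by
    intro h0
    obtain ⟨v, hv0, hv⟩ := Matrix.exists_mulVec_eq_zero_iff.mpr h0
    refine hv0 (funext fun s => ?_)
    have := hp.moore_columns hq ha (fun j => if h : j ∈ Z then v (e ⟨j, h⟩) else 0) ?_
      (e.symm s) (e.symm s).2
    · simpa using this
    · intro t ht
      have := congrFun hv ⟨t, ht⟩
      rw [← sum_coe_sort, ← e.symm.sum_comp]
      simpa [Matrix.mulVec, dotProduct, M, mul_comm] using this
  intro t ht
  by_contra h
  refine hdet (Matrix.exists_vecMul_eq_zero_iff.mp ⟨fun t => f t, fun h0 => ?_, ?_⟩)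
  · exact h (congrFun h0 ⟨t, ht⟩)
  · funext s
    have := hf (e.symm s) (e.symm s).2
    rw [← Fin.sum_univ_eq_sum_range (fun t => f t * mooreEntry q (a (b (e.symm s)))
      (p (e.symm s)) t)] at this
    simpa [Matrix.vecMul, dotProduct, M] using this

theorem BlockIndep.exists_monic [Fintype F] {q : ℕ} (hq : Fintype.card F = q) {a : κ → L}
    (ha : NonConj q a) (hp : BlockIndep F b p Z) :
    ∃ g : ℕ → L, g Z.card = 1 ∧ (∀ t > Z.card, g t = 0) ∧
      ∀ j ∈ Z, ∑ t ∈ range (Z.card + 1), g t * mooreEntry q (a (b j)) (p j) t = 0 := by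
  classical
  let φ : (Fin Z.card → L) →ₗ[L] (Z → L) :=
    { toFun := fun f j => ∑ t, f t * mooreEntry q (a (b j)) (p j) t
      map_add' := fun f g => by funext j; simp [add_mul, sum_add_distrib]
      map_smul' := fun c f => by funext j; simp [mul_sum, mul_assoc] }
  have hinj : Function.Injective φ := by
    rw [← LinearMap.ker_eq_bot, LinearMap.ker_eq_bot']
    intro f hf
    have := hp.moore_rows hq ha (fun t => if h : t < Z.card then f ⟨t, h⟩ else 0) ?_
    · funext t
      simpa using this t t.2
    · intro j hj
      rw [← Fin.sum_univ_eq_sum_range (fun t => (if h : t < Z.card then f ⟨t, h⟩ else 0) *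
        mooreEntry q (a (b j)) (p j) t)]
      simpa [φ] using congrFun hf ⟨j, hj⟩
  have hsurj : Function.Surjective φ :=
    (LinearMap.injective_iff_surjective_of_finrank_eq_finrank (by simp)).mp hinj
  obtain ⟨f, hf⟩ := hsurj fun j => -mooreEntry q (a (b j)) (p j) Z.card
  refine ⟨fun t => if h : t < Z.card then f ⟨t, h⟩ else if t = Z.card then 1 else 0,
    by simp, fun t ht => ?_, fun j hj => ?_⟩
  · dsimp only
    rw [dif_neg (by omega), if_neg (by omega)]
  · have := congrFun hf ⟨j, hj⟩
    rw [sum_range_succ, ← Fin.sum_univ_eq_sum_range (fun t => (if h : t < Z.card then f ⟨t, h⟩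
      else if t = Z.card then 1 else 0) * mooreEntry q (a (b j)) (p j) t)]
    simp only [φ, LinearMap.coe_mk, AddHom.coe_mk] at this
    simp [this]

end Independence

/-- Polynomials in the skew sense, one for each `i`, vanishing on the points indexed by `Z i` and
with coefficients in degrees `< r`, can only sum to zero if they all vanish. -/
def RowIndep {ι J κ L : Type*} [Fintype ι] [Field L] (q : ℕ) (a : κ → L) (b : J → κ) (r : ℕ)
    (Z : ι → Finset J) (p : J → L) : Prop :=
  ∀ f : ι → ℕ → L,
    (∀ i, ∀ j ∈ Z i, ∑ t ∈ range r, f i t * mooreEntry q (a (b j)) (p j) t = 0) →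
    (∀ t < r, ∑ i, f i t = 0) → ∀ i, ∀ t < r, f i t = 0

theorem Matrix.exists_mul_eq_one_of_linearIndependent {ι τ L : Type*} [Fintype ι] [DecidableEq ι]
    [Fintype τ] [Field L] (M : Matrix ι τ L) (hM : LinearIndependent L M.row) :
    ∃ A : Matrix τ ι L, M * A = 1 := by
  classical
  have hinj : Function.Injective M.vecMulLinear :=
    Matrix.vecMul_injective_iff.mpr hM
  obtain ⟨g, hg⟩ := LinearMap.exists_leftInverse_of_injective M.vecMulLinear
    (LinearMap.ker_eq_bot.mpr hinj)
  refine ⟨(LinearMap.toMatrix' g).transpose, ?_⟩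
  ext i i'
  have h1 := congrFun (LinearMap.congr_fun hg (Pi.single i 1)) i'
  have h2 : g (M i) = (LinearMap.toMatrix' g).mulVec (M i) := by simp
  simp only [LinearMap.comp_apply, LinearMap.id_apply, Matrix.vecMulLinear_apply,
    Matrix.single_one_vecMul] at h1
  rw [Matrix.row, h2] at h1
  rw [Matrix.mul_apply, Matrix.one_apply]
  simp only [Matrix.mulVec, dotProduct, Pi.single_apply] at h1
  simp only [Matrix.transpose_apply, eq_comm (a := i), ← h1]
  exact sum_congr rfl fun _ _ => mul_comm _ _

theorem Matrix.natDegree_det_le_sum {ι L : Type*} [Fintype ι] [DecidableEq ι] [CommRing L]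
    (M : Matrix ι ι (Polynomial L)) (d : ι → ℕ) (hM : ∀ i i', (M i i').natDegree ≤ d i) :
    M.det.natDegree ≤ ∑ i, d i := by
  rw [Matrix.det_apply]
  refine Polynomial.natDegree_sum_le_of_forall_le _ _ fun σ _ => ?_
  refine (Polynomial.natDegree_smul_le _ _).trans ((Polynomial.natDegree_prod_le _ _).trans ?_)
  rw [← Equiv.sum_comp σ d]
  exact sum_le_sum fun i _ => hM _ _

theorem Matrix.exists_polynomial_linearIndependent_row {ι τ L : Type*} [Fintype ι]
    [Fintype τ] [Field L] (M : Matrix ι τ (Polynomial L)) (d : ι → ℕ)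
    (hM : ∀ i t, (M i t).natDegree ≤ d i) (y₀ : L)
    (h₀ : LinearIndependent L (M.map (Polynomial.eval y₀)).row) :
    ∃ P : Polynomial L, P ≠ 0 ∧ P.natDegree ≤ ∑ i, d i ∧
      ∀ y, P.eval y ≠ 0 → LinearIndependent L (M.map (Polynomial.eval y)).row := by
  classical
  obtain ⟨A, hA⟩ := Matrix.exists_mul_eq_one_of_linearIndependent _ h₀
  have heval : ∀ y, (M * A.map Polynomial.C).det.eval y =
      (M.map (Polynomial.eval y) * A).det := by
    intro y
    rw [← Polynomial.coe_evalRingHom, RingHom.map_det]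
    congr 1
    ext i i'
    simp [Matrix.mul_apply, Polynomial.eval_finsetSum]
  refine ⟨(M * A.map Polynomial.C).det, ?_, Matrix.natDegree_det_le_sum _ _ fun i i' => ?_,
    fun y hy => ?_⟩
  · intro h
    have := heval y₀
    rw [h, hA, Matrix.det_one, Polynomial.eval_zero] at this
    exact zero_ne_one this
  · rw [Matrix.mul_apply]
    refine Polynomial.natDegree_sum_le_of_forall_le _ _ fun t _ => ?_
    rw [Matrix.map_apply]
    exact (Polynomial.natDegree_mul_C_le _ _).trans (hM i t)
  · rw [heval] at hy
    rw [← Matrix.vecMul_injective_iff]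
    have hinj : Function.Injective (M.map (Polynomial.eval y) * A).vecMul :=
      Matrix.vecMul_injective_of_isUnit
        ((Matrix.isUnit_iff_isUnit_det _).mpr (isUnit_iff_ne_zero.mpr hy))
    intro v w hvw
    refine hinj ?_
    dsimp only at hvw ⊢
    rw [← Matrix.vecMul_vecMul, hvw, Matrix.vecMul_vecMul]

section Rows

variable {F ι J κ L : Type*} [Field F] [Fintype F] [Field L] [Algebra F L] [DecidableEq κ]
  [Fintype ι] {q : ℕ} {a : κ → L} {b : J → κ} {r : ℕ} {Z : ι → Finset J} {p : J → L}

theorem BlockIndep.eq_smul_monic (hq : Fintype.card F = q) (ha : NonConj q a) {W : Finset J}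
    (hp : BlockIndep F b p W) (hW : W.card + 1 = r) {f ρ : ℕ → L}
    (hf : ∀ j ∈ W, ∑ t ∈ range r, f t * mooreEntry q (a (b j)) (p j) t = 0)
    (hρ : ∀ j ∈ W, ∑ t ∈ range r, ρ t * mooreEntry q (a (b j)) (p j) t = 0)
    (hρ1 : ρ (r - 1) = 1) : ∀ t < r, f t = f (r - 1) * ρ t := by
  subst hW
  rw [Nat.add_sub_cancel] at *
  have := hp.moore_rows hq ha (fun t => f t - f W.card * ρ t) fun j hj => by
    have h1 := hf j hj
    have h2 := hρ j hj
    rw [sum_range_succ] at h1 h2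
    rw [hρ1, one_mul] at h2
    simp only [sub_mul, sum_sub_distrib, mul_assoc, ← mul_sum]
    linear_combination h1 - f W.card * h2
  intro t ht
  rcases Nat.lt_succ_iff_lt_or_eq.mp ht with h | rfl
  · exact sub_eq_zero.mp (this t h)
  · rw [hρ1, mul_one]

theorem rowIndep_iff_linearIndependent (hq : Fintype.card F = q) (ha : NonConj q a)
    (hp : ∀ i, BlockIndep F b p (Z i)) (hZ : ∀ i, (Z i).card + 1 = r) (ρ : ι → ℕ → L)
    (hρ : ∀ i, ∀ j ∈ Z i, ∑ t ∈ range r, ρ i t * mooreEntry q (a (b j)) (p j) t = 0)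
    (hρ1 : ∀ i, ρ i (r - 1) = 1) :
    RowIndep q a b r Z p ↔ LinearIndependent L fun i => fun t : Fin r => ρ i t := by
  rw [Fintype.linearIndependent_iff]
  constructor
  · intro h g hg i
    have := h (fun i t => g i * ρ i t) (fun i j hj => by
      simp only [mul_assoc, ← mul_sum, hρ i j hj, mul_zero]) (fun t ht => by
        simpa using congrFun hg ⟨t, ht⟩) i (r - 1) (by have := hZ i; omega)
    simpa [hρ1] using this
  · intro h f hf hsum
    have hfρ := fun i => (hp i).eq_smul_monic hq ha (hZ i) (hf i) (hρ i) (hρ1 i)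
    have := h (fun i => f i (r - 1)) (by
      funext t
      rw [Pi.zero_apply, ← hsum t t.2, Finset.sum_apply]
      exact sum_congr rfl fun i _ => (hfρ i t t.2).symm)
    intro i t ht
    rw [hfρ i t ht, this i, zero_mul]

theorem sum_pow_card (hq : Fintype.card F = q) {α : Type*} (s : Finset α) (g : α → L) :
    (∑ x ∈ s, g x) ^ q = ∑ x ∈ s, g x ^ q := by
  have := map_sum (FiniteField.frobeniusAlgHom F L) g s
  simpa only [FiniteField.coe_frobeniusAlgHom, hq] using this

theorem BlockIndep.exists_polynomial_monic [DecidableEq J] (hq : Fintype.card F = q)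
    (ha : NonConj q a) [Fintype J] (hp : BlockIndep F b p univ) {W : Finset J}
    (hW : W.card + 1 = r) (j₀ : J) :
    ∃ ρ : ℕ → Polynomial L, ρ (r - 1) = 1 ∧
      (∀ t, (ρ t).natDegree ≤ if j₀ ∈ W then (q - 1) * q ^ (r - 2) else 0) ∧
      ∀ y, ∀ j ∈ W, ∑ t ∈ range r, (ρ t).eval y *
        mooreEntry q (a (b j)) (Function.update p j₀ y j) t = 0 := by
  have hq2 : 2 ≤ q := hq ▸ Fintype.one_lt_card
  subst hW
  by_cases hj₀ : j₀ ∈ W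
  · obtain ⟨s, hs⟩ : ∃ s, W.card = s + 1 :=
      Nat.exists_eq_succ_of_ne_zero (card_ne_zero_of_mem hj₀)
    have hs' : (W.erase j₀).card = s := by rw [card_erase_of_mem hj₀]; omega
    obtain ⟨g, hg1, hg0, hg⟩ := (hp.mono (subset_univ (W.erase j₀))).exists_monic hq ha
    rw [hs'] at hg1 hg0 hg
    have hshift : ∀ a' z : L, ∑ t ∈ range (s + 2), (if t = 0 then 0 else g (t - 1)) ^ q *
        mooreEntry q a' z t = a' * (∑ t ∈ range (s + 1), g t * mooreEntry q a' z t) ^ q := by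
      intro a' z
      rw [sum_range_succ', sum_pow_card hq, mul_sum]
      simp only [if_true, zero_pow (show q ≠ 0 by omega), zero_mul, add_zero,
        Nat.add_one_ne_zero, if_false, Nat.add_sub_cancel]
      refine sum_congr rfl fun t _ => ?_
      rw [mooreEntry_succ' hq2]
      ring
    let Y : Polynomial L := ∑ t ∈ range (s + 1), Polynomial.C (g t) *
      mooreEntry q (Polynomial.C (a (b j₀))) Polynomial.X t
    have hYdeg : Y.natDegree ≤ q ^ s := by
      refine Polynomial.natDegree_sum_le_of_forall_le _ _ fun t ht => ?_
      rw [mooreEntry, ← Polynomial.C_pow]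
      refine (Polynomial.natDegree_C_mul_le _ _).trans
        ((Polynomial.natDegree_C_mul_X_pow_le _ _).trans ?_)
      exact Nat.pow_le_pow_right (by omega) (by have := mem_range.mp ht; omega)
    have hYeval : ∀ y, Y.eval y = ∑ t ∈ range (s + 1), g t * mooreEntry q (a (b j₀)) y t := by
      intro y
      simp [Y, Polynomial.eval_finsetSum, mooreEntry]
    refine ⟨fun t => Polynomial.C ((if t = 0 then 0 else g (t - 1)) ^ q) -
      Polynomial.C (a (b j₀)) * Y ^ (q - 1) * Polynomial.C (g t), ?_, ?_, ?_⟩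
    · simp [hs, hg1, hg0]
    · intro t
      rw [if_pos hj₀, hs, show s + 1 + 1 - 2 = s by omega]
      refine (Polynomial.natDegree_sub_le _ _).trans (max_le (by simp) ?_)
      refine (Polynomial.natDegree_mul_C_le _ _).trans
        ((Polynomial.natDegree_C_mul_le _ _).trans (Polynomial.natDegree_pow_le.trans ?_))
      exact Nat.mul_le_mul_left _ hYdeg
    · intro y j hj
      rw [hs]
      simp only [Polynomial.eval_sub, Polynomial.eval_C, Polynomial.eval_mul,
        Polynomial.eval_pow, hYeval, sub_mul, sum_sub_distrib, hshift]
      simp only [mul_assoc, ← mul_sum]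
      rw [sum_range_succ _ (s + 1), hg0 (s + 1) (by omega), zero_mul, add_zero]
      by_cases hjj : j = j₀
      · subst hjj
        rw [Function.update_self, ← pow_succ, Nat.sub_add_cancel (by omega), sub_self]
      · rw [Function.update_of_ne hjj, hg j (mem_erase.mpr ⟨hjj, hj⟩),
          zero_pow (by omega)]
        ring
  · obtain ⟨g, hg1, -, hg⟩ := (hp.mono (subset_univ W)).exists_monic hq ha
    refine ⟨fun t => Polynomial.C (g t), by simp [hg1], by simp, fun y j hj => ?_⟩
    have hjj : j ≠ j₀ := fun h => hj₀ (h ▸ hj)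
    simpa [Function.update_of_ne hjj] using hg j hj

end Rows

section Update

variable {F ι J κ L : Type*} [Field F] [Field L] [Algebra F L] [DecidableEq κ]
  {q : ℕ} {a : κ → L} {b : J → κ} {r : ℕ} {Z : ι → Finset J} {p : J → L}

theorem BlockIndep.update [DecidableEq J] [Fintype J] (hp : BlockIndep F b p univ) {j₀ : J} {y : L}
    (hy : y ∉ Submodule.span F (p '' {j | j ≠ j₀ ∧ b j = b j₀})) :
    BlockIndep F b (Function.update p j₀ y) univ := by
  intro l w hw
  have h0 : b j₀ = l → w j₀ = 0 := by
    rintro rfl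
    by_contra hne
    apply hy
    rw [← add_sum_erase _ _ (show j₀ ∈ ({j | b j = b j₀} : Finset J) by simp), Function.update_self] at hw
    rw [← inv_smul_smul₀ hne y, eq_neg_of_add_eq_zero_left hw]
    refine Submodule.smul_mem _ _ (Submodule.neg_mem _ (Submodule.sum_mem _ fun i hi =>
      Submodule.smul_mem _ _ (Submodule.subset_span ⟨i, ?_, ?_⟩)))
    · exact ⟨ne_of_mem_erase hi, (mem_filter.mp (mem_of_mem_erase hi)).2⟩
    · rw [Function.update_of_ne (ne_of_mem_erase hi)]
  refine hp l w ?_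
  rw [← hw]
  refine sum_congr rfl fun i hi => ?_
  rcases eq_or_ne i j₀ with rfl | h
  · rw [h0 (mem_filter.mp hi).2, zero_smul, zero_smul]
  · rw [Function.update_of_ne h]

theorem card_algebraMap_mem_span_le [Fintype F] {K : Type*} [Field K] [Fintype K] [Algebra F K]
    [Algebra K L]
    [IsScalarTower F K L] (hq : Fintype.card F = q) (s : Finset J) [DecidablePred fun x : K =>
      algebraMap K L x ∈ Submodule.span F (p '' s)] :
    #{x : K | algebraMap K L x ∈ Submodule.span F (p '' s)} ≤ q ^ #s := by
  let S := Submodule.span F (p '' s)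
  let φ := (IsScalarTower.toAlgHom F K L).toLinearMap
  have : FiniteDimensional F S := FiniteDimensional.span_of_finite F (s.finite_toSet.image p)
  have h1 : Module.finrank F (S.comap φ) ≤ Module.finrank F S :=
    LinearMap.finrank_le_finrank_of_injective (f := φ.restrict (p := S.comap φ) fun _ h => h)
      fun x y hxy => Subtype.ext ((algebraMap K L).injective (congrArg Subtype.val hxy))
  have h2 : Module.finrank F S ≤ #s := by
    classical
    have := finrank_span_finset_le_card (R := F) (s.image p)
    rw [coe_image] at this
    exact this.trans card_image_le
  calc _ = Nat.card (S.comap φ) := (Nat.subtype_card _ fun x => by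
        rw [mem_filter]; exact and_iff_right (mem_univ x)).symm
    _ = q ^ Module.finrank F (S.comap φ) := by
      rw [Module.natCard_eq_pow_finrank (K := F), Nat.card_eq_fintype_card, hq]
    _ ≤ q ^ #s := Nat.pow_le_pow_right (hq ▸ Fintype.card_pos) (h1.trans h2)

theorem card_bad_lt {q m r c : ℕ} (hq : 2 ≤ q) (hm : 1 ≤ m) (hc : c + 1 ≤ r)
    (hqm : r * q ^ (r - 1) ≤ q ^ m) : c * ((q - 1) * q ^ (r - 2)) + q ^ (m - 1) < q ^ m := by
  obtain ⟨m, rfl⟩ := Nat.exists_eq_add_of_le' hm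
  obtain ⟨u, rfl⟩ := Nat.exists_eq_add_of_le' hq
  have hpos : 0 < (u + 2) ^ m := by positivity
  rw [Nat.add_sub_cancel, show u + 2 - 1 = u + 1 by omega]
  rcases Nat.lt_or_ge r 2 with h | h
  · obtain rfl : c = 0 := by omega
    rw [pow_succ]
    nlinarith
  · obtain ⟨s, rfl⟩ := Nat.exists_eq_add_of_le' h
    rw [show s + 2 - 1 = s + 1 by omega, pow_succ, pow_succ, ← mul_assoc] at hqm
    have h1 := Nat.le_of_mul_le_mul_right hqm (by omega)
    rw [Nat.add_sub_cancel, pow_succ]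
    have hs : 0 < (u + 2) ^ s := by positivity
    have h2 : c * (u + 2) ^ s < (u + 2) ^ m :=
      lt_of_lt_of_le (Nat.mul_lt_mul_of_pos_right (by omega) hs) h1
    calc _ = (u + 1) * (c * (u + 2) ^ s) + (u + 2) ^ m := by ring
      _ < (u + 1) * (u + 2) ^ m + (u + 2) ^ m := by gcongr
      _ = _ := by ring

variable [Fintype F] [Fintype ι] [Fintype J] [DecidableEq J]

theorem RowIndep.exists_update {K : Type*} [Field K] [Fintype K] [Algebra F K] [Algebra K L]
    [IsScalarTower F K L] (hq : Fintype.card F = q) (ha : NonConj q a)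
    (hp : BlockIndep F b p univ) (hZ : ∀ i, (Z i).card + 1 = r) (hD : RowIndep q a b r Z p)
    (j₀ : J) (hcount : #{i | j₀ ∈ Z i} + 1 ≤ r)
    {m : ℕ} (hm : Fintype.card K = q ^ m) (hblock : #{j | b j = b j₀} ≤ m)
    (hqm : r * q ^ (r - 1) ≤ q ^ m) :
    ∃ x : K, BlockIndep F b (Function.update p j₀ (algebraMap K L x)) univ ∧
      RowIndep q a b r Z (Function.update p j₀ (algebraMap K L x)) := by
  classical
  have hq2 : 2 ≤ q := hq ▸ Fintype.one_lt_card
  choose ρ hρ1 hρdeg hρ using fun i => hp.exists_polynomial_monic hq ha (hZ i) j₀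
  let M : Matrix ι (Fin r) (Polynomial L) := fun i t => ρ i t
  have hiff : ∀ y, BlockIndep F b (Function.update p j₀ y) univ →
      (RowIndep q a b r Z (Function.update p j₀ y) ↔
        LinearIndependent L (M.map (Polynomial.eval y)).row) := fun y hy =>
    rowIndep_iff_linearIndependent hq ha (fun i => hy.mono (subset_univ _)) hZ
      (fun i t => (ρ i t).eval y) (fun i => hρ i y) fun i => by rw [hρ1, Polynomial.eval_one]
  obtain ⟨P, hP0, hPdeg, hP⟩ := Matrix.exists_polynomial_linearIndependent_row M
    (fun i => if j₀ ∈ Z i then (q - 1) * q ^ (r - 2) else 0) (fun i t => hρdeg i t) (p j₀)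
    ((hiff (p j₀) (by rwa [Function.update_eq_self])).mp (by rwa [Function.update_eq_self]))
  rw [← sum_filter, sum_const, smul_eq_mul] at hPdeg
  set s : Finset J := ({j | b j = b j₀} : Finset J).erase j₀ with hs
  have hj₀ : j₀ ∈ ({j | b j = b j₀} : Finset J) := by simp
  have hscard : #s ≤ m - 1 := by
    rw [hs, card_erase_of_mem hj₀]
    omega
  have hm1 : 1 ≤ m := (card_pos.mpr ⟨j₀, hj₀⟩).trans_le hblock
  have hB1 : #{x : K | P.eval (algebraMap K L x) = 0} ≤ P.natDegree := by
    refine (card_le_card_of_injOn (algebraMap K L) (t := P.roots.toFinset) ?_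
      (algebraMap K L).injective.injOn).trans
      ((Multiset.toFinset_card_le _).trans (Polynomial.card_roots' P))
    intro x hx
    simpa [hP0] using hx
  have hB2 := card_algebraMap_mem_span_le (K := K) (p := p) hq s
  obtain ⟨x, -, hx⟩ : ∃ x ∈ (univ : Finset K), x ∉
      ({x : K | P.eval (algebraMap K L x) = 0} : Finset K) ∪
        ({x : K | algebraMap K L x ∈ Submodule.span F (p '' s)} : Finset K) := by
    apply exists_mem_notMem_of_card_lt_card
    rw [card_univ, hm]
    have h1 := card_bad_lt hq2 hm1 hcount hqm
    have h2 := Nat.pow_le_pow_right (show 0 < q by omega) hscard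
    exact (card_union_le _ _).trans_lt (by omega)
  simp only [mem_union, mem_filter, mem_univ, true_and, not_or] at hx
  have hblk : BlockIndep F b (Function.update p j₀ (algebraMap K L x)) univ := by
    refine hp.update ?_
    convert hx.2 using 4
    ext j
    simp [hs, and_comm]
  exact ⟨x, hblk, (hiff _ hblk).mpr (hP _ hx.1)⟩

theorem RowIndep.exists_algebraMap {K : Type*} [Field K] [Fintype K] [Algebra F K] [Algebra K L]
    [IsScalarTower F K L] (hq : Fintype.card F = q) {a : κ → K}
    (ha : NonConj q fun l => algebraMap K L (a l))
    (hp : BlockIndep F b p univ) (hZ : ∀ i, (Z i).card + 1 = r)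
    (hD : RowIndep q (fun l => algebraMap K L (a l)) b r Z p)
    (hcount : ∀ j₀, #{i | j₀ ∈ Z i} + 1 ≤ r)
    {m : ℕ} (hm : Fintype.card K = q ^ m) (hblock : ∀ l, #{j | b j = l} ≤ m)
    (hqm : r * q ^ (r - 1) ≤ q ^ m) :
    ∃ β : J → K, BlockIndep F b β univ ∧ RowIndep q a b r Z β := by
  classical
  have key : ∀ s : Finset J, ∃ p : J → L, (∀ j ∈ s, ∃ x : K, p j = algebraMap K L x) ∧
      BlockIndep F b p univ ∧ RowIndep q (fun l => algebraMap K L (a l)) b r Z p := by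
    intro s
    induction s using Finset.induction_on with
    | empty => exact ⟨p, by simp, hp, hD⟩
    | insert j₀ s _ ih =>
      obtain ⟨p, hps, hp, hD⟩ := ih
      obtain ⟨x, hx1, hx2⟩ := hD.exists_update (K := K) hq ha hp hZ j₀ (hcount j₀) hm
        (hblock _) hqm
      refine ⟨_, fun j hj => ?_, hx1, hx2⟩
      rcases eq_or_ne j j₀ with rfl | h
      · exact ⟨x, by simp⟩
      · rw [Function.update_of_ne h]
        exact hps j ((mem_insert.mp hj).resolve_left h)
  obtain ⟨p, hps, hp, hD⟩ := key univ
  choose β hβ using fun j => hps j (mem_univ j)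
  have hinj := (algebraMap K L).injective
  have hentry : ∀ j t, mooreEntry q (algebraMap K L (a (b j))) (p j) t =
      algebraMap K L (mooreEntry q (a (b j)) (β j) t) := by
    intro j t
    rw [hβ, mooreEntry, mooreEntry, map_mul, map_pow, map_pow]
  refine ⟨β, fun l w hw => hp l w ?_, fun f hf hsum i t ht => ?_⟩
  · have := congrArg (IsScalarTower.toAlgHom F K L) hw
    rw [map_sum, map_zero] at this
    rw [← this]
    refine sum_congr rfl fun j _ => ?_
    rw [map_smul, hβ]
    rfl
  · apply hinj
    rw [map_zero]
    refine hD (fun i t => algebraMap K L (f i t)) (fun i j hj => ?_) (fun t ht => ?_) i t ht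
    · simp only [hentry, ← map_mul, ← map_sum, hf i j hj, map_zero]
    · rw [← map_sum, hsum t ht, map_zero]

end Update

section Generic

variable {F ι J κ K : Type*} [Field F] [Field K] [Algebra F K] {q : ℕ}
  {a : κ → K} {b : J → κ} {r : ℕ} {Z : ι → Finset J}

theorem NonConj.fractionRing (hq : 2 ≤ q) (ha : NonConj q a) :
    NonConj q fun l => algebraMap K (FractionRing (MvPolynomial J K)) (a l) := by
  have hinj := (algebraMap K (FractionRing (MvPolynomial J K))).injective
  refine ⟨fun l => (map_ne_zero _).mpr (ha.1 l), fun l l' hne c hc h => ?_⟩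
  have h1 : c ^ (q - 1) = algebraMap (MvPolynomial J K) (FractionRing (MvPolynomial J K))
      (MvPolynomial.C (a l / a l')) := by
    rw [← MvPolynomial.algebraMap_eq, ← IsScalarTower.algebraMap_apply, map_div₀,
      eq_div_iff ((map_ne_zero _).mpr (ha.1 l')), ← h]
  obtain ⟨y, rfl⟩ := IsIntegrallyClosed.exists_algebraMap_eq_of_isIntegral_pow
    (R := MvPolynomial J K) (show 0 < q - 1 by omega) (h1 ▸ isIntegral_algebraMap)
  rw [← map_pow] at h1
  have h2 := congrArg MvPolynomial.constantCoeff (IsFractionRing.injective _ _ h1)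
  rw [map_pow, MvPolynomial.constantCoeff_C] at h2
  refine ha.2 l l' hne (MvPolynomial.constantCoeff y) (fun h0 => ?_) ?_
  · rw [h0, zero_pow (by omega)] at h2
    exact div_ne_zero (ha.1 l) (ha.1 l') h2.symm
  · rw [h2, div_mul_cancel₀ _ (ha.1 l')]

theorem blockIndep_X [DecidableEq κ] [Fintype J] : BlockIndep F b (fun j =>
    algebraMap (MvPolynomial J K) (FractionRing (MvPolynomial J K)) (MvPolynomial.X j)) univ := by
  classical
  intro l w hw j _ hb
  have h1 : ∑ i with b i = l, w i • (MvPolynomial.X i : MvPolynomial J K) = 0 := by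
    apply IsFractionRing.injective (MvPolynomial J K) (FractionRing (MvPolynomial J K))
    rw [map_zero, ← hw, map_sum]
    refine sum_congr rfl fun i _ => ?_
    simp only [Algebra.algebraMap_eq_smul_one, smul_assoc]
  have h2 := congrArg (MvPolynomial.coeff (Finsupp.single j 1)) h1
  rw [MvPolynomial.coeff_sum, sum_eq_single_of_mem j (by simp [hb]) fun i _ hij => by
    rw [MvPolynomial.coeff_smul, MvPolynomial.coeff_X, if_neg, smul_zero]
    intro h
    exact hij (Finsupp.single_left_injective one_ne_zero h)] at h2
  rw [MvPolynomial.coeff_smul, MvPolynomial.coeff_X, MvPolynomial.coeff_zero,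
    if_pos rfl, Algebra.smul_def, mul_one] at h2
  exact (map_eq_zero _).mp h2

theorem rowIndep_X [Fintype ι] (hq : 2 ≤ q) (ha : ∀ l, a l ≠ 0)
    (hZ : ∀ i, (Z i).card + 1 = r)
    (hH : ∀ Ω : Finset ι, Ω.Nonempty → ∀ W, (∀ i ∈ Ω, W ⊆ Z i) → W.card + Ω.card ≤ r) :
    RowIndep q (fun l => algebraMap K (FractionRing (MvPolynomial J K)) (a l)) b r Z (fun j =>
      algebraMap (MvPolynomial J K) (FractionRing (MvPolynomial J K)) (MvPolynomial.X j)) := by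
  intro f hf hsum
  have hinj := IsFractionRing.injective (MvPolynomial J K) (FractionRing (MvPolynomial J K))
  obtain ⟨d, hd⟩ := IsLocalization.exist_integer_multiples (nonZeroDivisors (MvPolynomial J K))
    ((univ : Finset ι) ×ˢ range r) fun x => f x.1 x.2
  have hd' : ∀ i t, ∃ g : MvPolynomial J K, t < r →
      algebraMap _ (FractionRing (MvPolynomial J K)) g =
        algebraMap _ (FractionRing (MvPolynomial J K)) d.1 * f i t := by
    intro i t
    by_cases ht : t < r
    · obtain ⟨g, hg⟩ := hd (i, t) (by simp [ht])
      exact ⟨g, fun _ => by rw [hg, Algebra.smul_def]⟩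
    · exact ⟨0, fun h => (ht h).elim⟩
  choose g hg using hd'
  have hd0 : algebraMap _ (FractionRing (MvPolynomial J K)) d.1 ≠ 0 :=
    IsFractionRing.to_map_ne_zero_of_mem_nonZeroDivisors d.2
  have hg0 := genericAdm_independent (k := r)
    (c := fun t j => a (b j) ^ ((q ^ t - 1) / (q - 1))) (e := fun t => q ^ t)
    (fun t j => pow_ne_zero _ (ha _)) (pow_right_strictMono₀ hq) univ Z
    (fun _ => 0) (fun _ => 1) (fun i _ => by simpa using hZ i) (fun _ _ => one_pos)
    (fun Ω _ hΩ W t hW ht => by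
      have := hH Ω hΩ W hW
      obtain ⟨i, hi⟩ := hΩ
      have : t ≤ 0 := ht i hi
      simp only [sum_const, smul_eq_mul, mul_one]
      omega) g (fun i _ => ⟨fun t _ h => by omega, fun j hj => ?_⟩) fun t ht => ?_
  · intro i t ht
    have := hg i t ht
    rw [hg0 i (mem_univ i) t ht, map_zero, eq_comm] at this
    exact (mul_eq_zero.mp this).resolve_left hd0
  · apply hinj
    have h := hf i j hj
    rw [map_zero, map_sum, ← mul_zero (algebraMap _ _ d.1), ← h, mul_sum]
    refine sum_congr rfl fun t ht => ?_
    rw [map_mul, hg i t (mem_range.mp ht), map_mul, map_pow, map_pow, map_pow,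
      ← MvPolynomial.algebraMap_eq, ← IsScalarTower.algebraMap_apply, mooreEntry]
    ring
  · apply hinj
    rw [map_zero, map_sum, ← mul_zero (algebraMap _ _ d.1), ← hsum t ht, mul_sum]
    exact sum_congr rfl fun i _ => hg i t ht

end Generic

section Extension

variable {ι J : Type*} [DecidableEq ι] [Fintype J] [DecidableEq J] {Z : ι → Finset J} {r : ℕ}

theorem exists_insert_of_card_inf_add_card_le
    (hr : r ≤ Fintype.card J)
    (hZ : ∀ Ω : Finset ι, Ω.Nonempty → (Ω.inf Z).card + Ω.card ≤ r)
    {i : ι} (hi : (Z i).card + 1 < r) :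
    ∃ j ∉ Z i, ∀ Ω : Finset ι, Ω.Nonempty →
      (Ω.inf (Function.update Z i (insert j (Z i)))).card + Ω.card ≤ r := by
  obtain ⟨B, hB, hBad⟩ : ∃ B : Finset J, B.card ≤ 1 ∧ ∀ Ω : Finset ι, i ∈ Ω →
      (Ω.inf Z).card + Ω.card = r → (Ω.erase i).inf Z \ Z i ⊆ B := by
    by_cases hex : ∃ n, ∃ Ω : Finset ι, Ω.card = n ∧ i ∈ Ω ∧ (Ω.inf Z).card + Ω.card = r
    · classical
      obtain ⟨Ω₀, hcard, hi₀, ht₀⟩ := Nat.find_spec hex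
      have hmin : ∀ Ω : Finset ι, i ∈ Ω → (Ω.inf Z).card + Ω.card = r → Ω₀ ⊆ Ω := by
        intro Ω hiΩ ht
        have h1 : ((Ω ∪ Ω₀).inf Z).card + (Ω ∪ Ω₀).card ≤ r :=
          hZ _ ⟨i, mem_union_left _ hiΩ⟩
        have h2 : ((Ω ∩ Ω₀).inf Z).card + (Ω ∩ Ω₀).card ≤ r :=
          hZ _ ⟨i, mem_inter.mpr ⟨hiΩ, hi₀⟩⟩
        have h3 := card_union_add_card_inter Ω Ω₀
        have h4 := card_union_add_card_inter (Ω.inf Z) (Ω₀.inf Z)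
        have h5 : (Ω ∪ Ω₀).inf Z = Ω.inf Z ∩ Ω₀.inf Z := inf_union
        have h6 : (Ω.inf Z ∪ Ω₀.inf Z).card ≤ ((Ω ∩ Ω₀).inf Z).card :=
          card_le_card (union_subset (inf_mono inter_subset_left) (inf_mono inter_subset_right))
        rw [h5] at h1
        have h7 : Nat.find hex ≤ (Ω ∩ Ω₀).card :=
          Nat.find_min' hex ⟨_, rfl, mem_inter.mpr ⟨hiΩ, hi₀⟩, by omega⟩
        have h8 := eq_of_subset_of_card_le (inter_subset_right (s₁ := Ω) (s₂ := Ω₀)) (by omega)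
        exact inter_eq_right.mp h8
      refine ⟨(Ω₀.erase i).inf Z \ Z i, ?_, fun Ω hiΩ ht =>
        sdiff_subset_sdiff (inf_mono (erase_subset_erase _ (hmin Ω hiΩ ht))) subset_rfl⟩
      have hne : (Ω₀.erase i).Nonempty := by
        rw [nonempty_iff_ne_empty, Ne, erase_eq_empty_iff]
        rintro (h | h)
        · simp [h] at hi₀
        · rw [h] at ht₀
          simp at ht₀
          omega
      have h1 := hZ _ hne
      have h2 : Ω₀.inf Z = Z i ∩ (Ω₀.erase i).inf Z := by
        conv_lhs => rw [← insert_erase hi₀, inf_insert]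
        rfl
      have h3 := card_sdiff_add_card_inter ((Ω₀.erase i).inf Z) (Z i)
      rw [inter_comm, ← h2] at h3
      have h4 := card_erase_of_mem hi₀
      have h5 : 0 < Ω₀.card := card_pos.mpr ⟨i, hi₀⟩
      omega
    · exact ⟨∅, by simp, fun Ω h1 h2 => (hex ⟨_, Ω, rfl, h1, h2⟩).elim⟩
  obtain ⟨j, -, hj⟩ : ∃ j ∈ univ, j ∉ Z i ∪ B := by
    apply exists_mem_notMem_of_card_lt_card
    have := card_union_le (Z i) B
    rw [card_univ]
    omega
  rw [mem_union, not_or] at hj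
  refine ⟨j, hj.1, fun Ω hΩ => ?_⟩
  have hrest : ∀ Ω : Finset ι, i ∉ Ω → Ω.inf (Function.update Z i (insert j (Z i))) = Ω.inf Z :=
    fun Ω h => inf_congr rfl fun i' hi' => Function.update_of_ne (by rintro rfl; exact h hi') _ _
  by_cases hiΩ : i ∈ Ω
  · have h1 : Ω.inf Z = Z i ∩ (Ω.erase i).inf Z := by
      conv_lhs => rw [← insert_erase hiΩ, inf_insert]
      rfl
    have h2 : Ω.inf (Function.update Z i (insert j (Z i))) =
        insert j (Z i) ∩ (Ω.erase i).inf Z := by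
      conv_lhs => rw [← insert_erase hiΩ, inf_insert, Function.update_self,
        hrest _ (notMem_erase _ _)]
      rfl
    have h3 := hZ Ω hΩ
    rw [h1] at h3
    rw [h2]
    by_cases hjΩ : j ∈ (Ω.erase i).inf Z
    · rw [insert_inter_of_mem hjΩ]
      have := card_insert_le j (Z i ∩ (Ω.erase i).inf Z)
      have hne : (Z i ∩ (Ω.erase i).inf Z).card + Ω.card ≠ r := fun h =>
        hj.2 (hBad Ω hiΩ (h1 ▸ h) (mem_sdiff.mpr ⟨hjΩ, hj.1⟩))
      omega
    · rwa [insert_inter_of_notMem hjΩ]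
  · rw [hrest Ω hiΩ]
    exact hZ Ω hΩ

theorem exists_extension_of_card_inf_add_card_le [Fintype ι]
    (hr : r ≤ Fintype.card J)
    (hZ : ∀ Ω : Finset ι, Ω.Nonempty → (Ω.inf Z).card + Ω.card ≤ r) :
    ∃ Z' : ι → Finset J, (∀ i, Z i ⊆ Z' i) ∧ (∀ i, (Z' i).card + 1 = r) ∧
      ∀ Ω : Finset ι, Ω.Nonempty → (Ω.inf Z').card + Ω.card ≤ r := by
  induction hD : ∑ i, (r - (Z i).card) using Nat.strong_induction_on generalizing Z with
  | _ D ih =>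
    by_cases hall : ∀ i, (Z i).card + 1 = r
    · exact ⟨Z, fun _ => subset_rfl, hall, hZ⟩
    obtain ⟨i, hi⟩ := not_forall.mp hall
    have hi' := hZ {i} (singleton_nonempty i)
    rw [inf_singleton, card_singleton] at hi'
    obtain ⟨j, hj, hins⟩ := exists_insert_of_card_inf_add_card_le hr hZ (i := i) (by omega)
    have hlt : ∑ i', (r - (Function.update Z i (insert j (Z i)) i').card) < D := by
      rw [← hD]
      refine sum_lt_sum (fun i' _ => ?_) ⟨i, mem_univ i, ?_⟩
      · rcases eq_or_ne i' i with rfl | h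
        · rw [Function.update_self, card_insert_of_notMem hj]
          omega
        · rw [Function.update_of_ne h]
      · rw [Function.update_self, card_insert_of_notMem hj]
        omega
    obtain ⟨Z', hsub, hZ'⟩ := ih _ hlt hins rfl
    refine ⟨Z', fun i' => ?_, hZ'⟩
    have := hsub i'
    rcases eq_or_ne i' i with rfl | h
    · rw [Function.update_self] at this
      exact (subset_insert _ _).trans this
    · rwa [Function.update_of_ne h] at this

end Extension

theorem exists_nonConj {K : Type*} [Field K] [Fintype K] {q m ℓ : ℕ} (hq : 2 ≤ q) (hm : 1 ≤ m)
    (hK : Fintype.card K = q ^ m) (hℓ : ℓ + 1 ≤ q) : ∃ a : Fin ℓ → K, NonConj q a := by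
  classical
  obtain ⟨γ, hγ⟩ := IsCyclic.exists_generator (α := Kˣ)
  have hord : orderOf γ = q ^ m - 1 := by
    rw [orderOf_eq_card_of_forall_mem_zpowers hγ, Nat.card_eq_fintype_card, Fintype.card_units, hK]
  obtain ⟨s, hs⟩ : q - 1 ∣ q ^ m - 1 := by simpa using Nat.sub_dvd_pow_sub_pow q 1 m
  have hpos : 0 < q ^ m - 1 := by
    have := Nat.pow_le_pow_right (show 0 < q by omega) hm
    rw [pow_one] at this
    omega
  have hs0 : 0 < s := Nat.pos_of_ne_zero fun h => by simp [h] at hs; omega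
  refine ⟨fun l => ((γ ^ (l : ℕ) : Kˣ) : K), fun l => Units.ne_zero _, fun l l' hne c hc h => hne ?_⟩
  obtain ⟨c, rfl⟩ := hc.isUnit
  have h1 : γ ^ (l : ℕ) = c ^ (q - 1) * γ ^ (l' : ℕ) := by
    ext
    simpa using h
  have hcs : (c ^ (q - 1)) ^ s = 1 := by
    rw [← pow_mul, ← hs, ← hK, ← Fintype.card_units, pow_card_eq_one]
  have h2 := congrArg (· ^ s) h1
  simp only [mul_pow, hcs, one_mul, ← pow_mul] at h2
  have hlt : ∀ l : Fin ℓ, (l : ℕ) * s < orderOf γ := fun l => by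
    rw [hord, hs]
    exact Nat.mul_lt_mul_of_pos_right (by omega) hs0
  exact Fin.ext (Nat.eq_of_mul_eq_mul_right hs0 (pow_injOn_Iio_orderOf (hlt l) (hlt l') h2))

theorem Finset.sum_filter_sigma_fst {κ M : Type*} [Fintype κ] [DecidableEq κ] {τ : κ → Type*}
    [∀ l, Fintype (τ l)] [AddCommMonoid M] (l : κ) (g : (Σ l, τ l) → M) :
    ∑ j with j.1 = l, g j = ∑ t, g ⟨l, t⟩ := by
  rw [sum_filter, Fintype.sum_sigma, sum_eq_single_of_mem l (mem_univ l)]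
  · simp
  · intro l' _ hne
    simp [hne]

section Weight

variable {F κ L : Type*} [Field F] [Field L] [Algebra F L] [Fintype κ] [DecidableEq κ]

theorem blockIndep_sigma_iff {τ : κ → Type*} [∀ l, Fintype (τ l)] {p : (Σ l, τ l) → L} :
    BlockIndep F Sigma.fst p univ ↔ ∀ l, LinearIndependent F fun t => p ⟨l, t⟩ := by
  simp only [Fintype.linearIndependent_iff, BlockIndep, sum_filter_sigma_fst]
  constructor
  · intro h l w hw t
    have := h l (fun j => if hj : j.1 = l then w (hj ▸ j.2) else 0) (by simpa using hw)
      ⟨l, t⟩ (mem_univ _) rfl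
    simpa using this
  · rintro h _ w hw ⟨l, t⟩ - rfl
    exact h l (fun t => w ⟨l, t⟩) hw t

variable [Fintype F] {q : ℕ} {a : κ → L}

theorem mooreEntry_sum_smul (hq : Fintype.card F = q) {α : Type*} (s : Finset α) (w : α → F)
    (x : α → L) (a : L) (t : ℕ) :
    mooreEntry q a (∑ i ∈ s, w i • x i) t = ∑ i ∈ s, w i • mooreEntry q a (x i) t := by
  have hq2 : 2 ≤ q := hq ▸ Fintype.one_lt_card
  induction t with
  | zero => simp
  | succ t ih =>
    rw [mooreEntry_succ' hq2, ih, sum_pow_card hq, mul_sum]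
    refine sum_congr rfl fun i _ => ?_
    rw [_root_.smul_pow, ← hq, FiniteField.pow_card, hq, mul_smul_comm, ← mooreEntry_succ' hq2]

theorem sum_lt_sumRankWt_add {ℓ : ℕ} {nn : Fin ℓ → ℕ} {a : Fin ℓ → L}
    (hq : Fintype.card F = q) (ha : NonConj q a)
    {p : ((l : Fin ℓ) × Fin (nn l)) → L} (hp : BlockIndep F Sigma.fst p univ) (f : ℕ → L) {r : ℕ}
    (hf : ∃ t < r, f t ≠ 0) :
    ∑ l, nn l <
      sumRankWt F (fun j => ∑ t ∈ range r, f t * mooreEntry q (a j.1) (p j) t) + r := by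
  classical
  set c : ((l : Fin ℓ) × Fin (nn l)) → L :=
    fun j => ∑ t ∈ range r, f t * mooreEntry q (a j.1) (p j) t with hc
  let ψ : (l : Fin ℓ) → (Fin (nn l) → F) →ₗ[F] L :=
    fun l => Fintype.linearCombination F fun t => c ⟨l, t⟩
  have hrank : ∀ l, rankFq F (fun t => c ⟨l, t⟩) + Module.finrank F (LinearMap.ker (ψ l)) =
      nn l := by
    intro l
    have := LinearMap.finrank_range_add_finrank_ker (ψ l)
    rwa [Fintype.range_linearCombination, Module.finrank_fin_fun] at this
  let u : (l : Fin ℓ) → Fin (Module.finrank F (LinearMap.ker (ψ l))) → Fin (nn l) → F :=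
    fun l s => (Module.finBasis F (LinearMap.ker (ψ l)) s).1
  let p' : (Σ l, Fin (Module.finrank F (LinearMap.ker (ψ l)))) → L :=
    fun x => ∑ t, u x.1 x.2 t • p ⟨x.1, t⟩
  have hp' : BlockIndep F Sigma.fst p' univ := by
    rw [blockIndep_sigma_iff] at hp ⊢
    intro l
    have h1 := (Module.finBasis F (LinearMap.ker (ψ l))).linearIndependent.map'
      (LinearMap.ker (ψ l)).subtype (Submodule.ker_subtype _)
    exact h1.map' (Fintype.linearCombination F fun t => p ⟨l, t⟩)
      (LinearMap.ker_eq_bot.mpr (hp l).fintypeLinearCombination_injective)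
  have hlt : ∑ l, Module.finrank F (LinearMap.ker (ψ l)) < r := by
    by_contra! hge
    obtain ⟨t, ht, hft⟩ := hf
    have hcard : (univ : Finset (Σ l, Fin (Module.finrank F (LinearMap.ker (ψ l))))).card =
        ∑ l, Module.finrank F (LinearMap.ker (ψ l)) := by simp
    have := hp'.moore_rows hq ha (fun t => if t < r then f t else 0) (fun x _ => ?_) t
      (by omega)
    · rw [if_pos ht] at this
      exact hft this
    · rw [hcard, ← sum_subset (range_subset_range.mpr hge) fun t _ ht => by
        rw [if_neg (by simpa using ht), zero_mul]]
      have hker : ψ x.1 (u x.1 x.2) = 0 :=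
        (Module.finBasis F (LinearMap.ker (ψ x.1)) x.2).2
      rw [← hker, Fintype.linearCombination_apply]
      simp only [hc, smul_sum]
      rw [sum_comm]
      refine sum_congr rfl fun t ht => ?_
      rw [if_pos (mem_range.mp ht), mooreEntry_sum_smul hq, mul_sum]
      exact sum_congr rfl fun i _ => mul_smul_comm _ _ _
  have hsum : sumRankWt F c + ∑ l, Module.finrank F (LinearMap.ker (ψ l)) = ∑ l, nn l := by
    rw [sumRankWt, ← sum_add_distrib]
    exact sum_congr rfl fun l _ => hrank l
  omega

end Weight

theorem exists_rowIndep {F κ J ι K : Type*} [Field F] [Fintype F] [Field K] [Fintype K]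
    [Algebra F K] [DecidableEq κ] [Fintype J] [DecidableEq J] [Fintype ι] {q m r : ℕ}
    (hq : Fintype.card F = q) (hm : Fintype.card K = q ^ m) {a : κ → K} (ha : NonConj q a)
    {b : J → κ} (hblock : ∀ l, #{j | b j = l} ≤ m) (hr : 1 ≤ r) (hqm : r * q ^ (r - 1) ≤ q ^ m)
    {Z : ι → Finset J} (hZ : ∀ i, (Z i).card + 1 = r)
    (hH : ∀ Ω : Finset ι, Ω.Nonempty → (Ω.inf Z).card + Ω.card ≤ r) :
    ∃ β : J → K, BlockIndep F b β univ ∧ RowIndep q a b r Z β := by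
  classical
  have hq2 : 2 ≤ q := hq ▸ Fintype.one_lt_card
  have hH' : ∀ Ω : Finset ι, Ω.Nonempty → ∀ W, (∀ i ∈ Ω, W ⊆ Z i) → W.card + Ω.card ≤ r :=
    fun Ω hΩ W hW => (Nat.add_le_add_right (card_le_card (Finset.le_inf hW)) _).trans (hH Ω hΩ)
  refine (rowIndep_X hq2 ha.1 hZ hH').exists_algebraMap hq (ha.fractionRing hq2) blockIndep_X hZ
    (fun j => ?_) hm hblock hqm
  rcases Finset.eq_empty_or_nonempty ({i | j ∈ Z i} : Finset ι) with h | h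
  · rw [h]
    simpa using hr
  · have := hH' _ h {j} fun i hi => by simpa using hi
    rw [card_singleton] at this
    omega

end

/-- For arbitrary support constraints `Z_1,…,Z_k`, there is a support-constrained
generator matrix of a subcode of an `[n, k̃]_{q^m}` linearized Reed–Solomon code
whose nonzero codewords all have sum-rank weight at least `n − k̃ + 1`. -/
theorem exists_subcode_of_LRS_with_support_constraints
    (q m ℓ k : ℕ) (nn : Fin ℓ → ℕ) (hℓ : 1 ≤ ℓ) (hnn : ∀ l, 1 ≤ nn l) (hk : 1 ≤ k)
    (Fq K : Type*) [Field Fq] [Fintype Fq] (hq : Fintype.card Fq = q)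
    [Field K] [Algebra Fq K] (hm : Module.finrank Fq K = m)
    (Z : Fin k → Finset ((l : Fin ℓ) × Fin (nn l)))
    (hktilde : ktilde Z ≤ ∑ l, nn l)
    (hqℓ : ℓ + 1 ≤ q) (hmn : ∀ l, nn l ≤ m)
    (hqm : ktilde Z * q ^ (ktilde Z - 1) ≤ q ^ m) :
    ∃ G : Matrix (Fin k) ((l : Fin ℓ) × Fin (nn l)) K,
      G.rank = k ∧
      (∀ (i : Fin k) (j : (l : Fin ℓ) × Fin (nn l)), j ∈ Z i → G i j = 0) ∧
      (∀ c ∈ Submodule.span K (Set.range fun i : Fin k => G i),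
        c ≠ 0 → (∑ l, nn l) - ktilde Z + 1 ≤ sumRankWt Fq c) ∧
      -- the row space of G is a subcode of an [n, k̃] linearized Reed–Solomon code
      (∃ (a : Fin ℓ → K) (β : (l : Fin ℓ) → Fin (nn l) → K),
        (∀ l, a l ≠ 0) ∧
        (∀ l l', l ≠ l' → ∀ c : K, c ≠ 0 → a l ≠ c ^ (q - 1) * a l') ∧
        (∀ l, LinearIndependent Fq (β l)) ∧
        Submodule.span K (Set.range fun i : Fin k => G i) ≤
          Submodule.span K (Set.range fun i : Fin (ktilde Z) =>
            (fun j : (l : Fin ℓ) × Fin (nn l) =>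
              a j.1 ^ ((q ^ (i : ℕ) - 1) / (q - 1)) * β j.1 j.2 ^ q ^ (i : ℕ)))) := by
  have hm1 : 1 ≤ m := (hnn ⟨0, hℓ⟩).trans (hmn _)
  have : Module.Finite Fq K := Module.finite_of_finrank_pos (by omega)
  have : Finite K := Module.finite_of_finite Fq
  have := Fintype.ofFinite K
  have hq2 : 2 ≤ q := hq ▸ Fintype.one_lt_card
  have hK : Fintype.card K = q ^ m := by rw [Module.card_eq_pow_finrank (K := Fq), hq, hm]
  have hH : ∀ Ω : Finset (Fin k), Ω.Nonempty → (Ω.inf Z).card + Ω.card ≤ ktilde Z := fun Ω hΩ =>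
    Finset.le_sup (f := fun Ω : Finset (Fin k) => (Ω.inf Z).card + Ω.card)
      (Finset.mem_filter.mpr ⟨Finset.mem_powerset.mpr (Finset.subset_univ Ω), hΩ⟩)
  generalize ktilde Z = r at *
  have hr : 1 ≤ r := by
    have := hH {⟨0, hk⟩} (Finset.singleton_nonempty _)
    rw [Finset.card_singleton] at this
    omega
  obtain ⟨Z', hZZ', hZ', hH'⟩ := exists_extension_of_card_inf_add_card_le (by simpa using hktilde) hH
  obtain ⟨a, ha⟩ := exists_nonConj hq2 hm1 hK hqℓ
  obtain ⟨β, hβ, hD⟩ := exists_rowIndep (b := Sigma.fst) hq hK ha (fun l => by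
    rw [Finset.card_eq_sum_ones, Finset.sum_filter_sigma_fst]
    simpa using hmn l) hr hqm hZ' hH'
  have hρ' : ∀ i, ∃ ρ : ℕ → K, ρ (r - 1) = 1 ∧
      ∀ j ∈ Z' i, ∑ t ∈ Finset.range r, ρ t * mooreEntry q (a j.1) (β j) t = 0 := by
    intro i
    obtain ⟨ρ, h1, -, h2⟩ := (hβ.mono (Finset.subset_univ (Z' i))).exists_monic hq ha
    rw [hZ' i] at h2
    exact ⟨ρ, by rwa [← hZ' i, Nat.add_sub_cancel], h2⟩
  choose ρ hρ1 hρ using hρ'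
  have hind := (rowIndep_iff_linearIndependent hq ha (fun i => hβ.mono (Finset.subset_univ _))
    hZ' ρ hρ hρ1).mp hD
  let G : Matrix (Fin k) ((l : Fin ℓ) × Fin (nn l)) K :=
    fun i j => ∑ t ∈ Finset.range r, ρ i t * mooreEntry q (a j.1) (β j) t
  have hcomb : ∀ y : Fin k → K, ∑ i, y i • G i = fun j => ∑ t ∈ Finset.range r,
      (∑ i, y i * ρ i t) * mooreEntry q (a j.1) (β j) t := by
    intro y
    funext j
    simp only [Finset.sum_apply, Pi.smul_apply, smul_eq_mul, G, Finset.mul_sum, Finset.sum_mul,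
      mul_assoc]
    exact Finset.sum_comm
  have hweight : ∀ y : Fin k → K, y ≠ 0 → ∑ l, nn l < sumRankWt Fq (∑ i, y i • G i) + r := by
    intro y hy
    rw [hcomb]
    refine sum_lt_sumRankWt_add hq ha hβ (fun t => ∑ i, y i * ρ i t) ?_
    by_contra! hzero
    refine hy (funext (Fintype.linearIndependent_iff.mp hind y (funext fun t => ?_)))
    rw [Finset.sum_apply]
    exact hzero t t.2
  refine ⟨G, ?_, fun i j hj => hρ i j (hZZ' i hj), fun c hc hc0 => ?_,
    a, fun l t => β ⟨l, t⟩, ha.1, ha.2, blockIndep_sigma_iff.mp hβ, ?_⟩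
  · have hG : LinearIndependent K G.row := by
      rw [Fintype.linearIndependent_iff]
      intro y hy
      by_contra hne
      have := hweight y fun h => hne (congrFun h)
      have hy' : ∑ i, y i • G i = 0 := hy
      have hz : sumRankWt Fq (0 : ((l : Fin ℓ) × Fin (nn l)) → K) = 0 :=
        Finset.sum_eq_zero fun l _ => by
          rw [rankFq, Submodule.span_eq_bot.mpr (by simp), finrank_bot]
      rw [hy', hz] at this
      omega
    rw [hG.rank_matrix, Fintype.card_fin]
  · obtain ⟨y, rfl⟩ := (Submodule.mem_span_range_iff_exists_fun K).mp hc
    have := hweight y fun h => hc0 (by simp [h])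
    omega
  · rw [Submodule.span_le]
    rintro _ ⟨i, rfl⟩
    refine (Submodule.mem_span_range_iff_exists_fun K).mpr ⟨fun t => ρ i t, ?_⟩
    funext j
    rw [Finset.sum_apply]
    exact Fin.sum_univ_eq_sum_range (fun t => ρ i t * mooreEntry q (a j.1) (β j) t) r
end
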